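/- arXiv:1402.6642 — 16 statements merged into one kernel-verified Lean document; each statement's English description precedes it below -/
import Mathlib

section
/- Let S be a set of endomorphisms of V whose action on V is orthogonally indecomposable. Let p be a g-self-adjoint endomorphism of V commuting with every element of S. Then the minimal polynomial of p over the reals is a power of a single monic irreducible polynomial; in particular, p is either invertible or nilpotent. -/
open Polynomial in
theorem aux_comm {V : Type*} [AddCommGroup V] [Module ℝ V]
    (p T : Module.End ℝ V) (h : Commute p T) (a : ℝ[X]) : Commute (aeval p a) T := by
  induction a using Polynomial.induction_on' with
  | add a b ha hb => rw [map_add]; exact ha.add_left hb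
  | monomial n r =>
    rw [aeval_monomial]
    exact Commute.mul_left (Algebra.commutes r T) (h.pow_left n)

open Polynomial in
theorem aux_aeval_selfadj {V : Type*} [AddCommGroup V] [Module ℝ V]
    (g : V →ₗ[ℝ] V →ₗ[ℝ] ℝ) (p : Module.End ℝ V)
    (hp : ∀ x y, g (p x) y = g x (p y)) (a : ℝ[X]) :
    ∀ x y, g (aeval p a x) y = g x (aeval p a y) := by
  induction a using Polynomial.induction_on' with
  | add a b ha hb => intro x y; simp [ha, hb]
  | monomial n r =>
    intro x y
    have h : ∀ n : ℕ, ∀ x y, g ((p ^ n) x) y = g x ((p ^ n) y) := by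
      intro n
      induction n with
      | zero => intro x y; simp
      | succ n ih =>
        intro x y
        rw [pow_succ, Module.End.mul_apply, ih, hp, ← Module.End.mul_apply, ← pow_succ', pow_succ]
    simp [aeval_monomial, Module.End.mul_apply, h, Module.algebraMap_end_apply]

/-- If `S` acts orthogonally indecomposably on `(V, g)` and `p` is a
`g`-self-adjoint endomorphism commuting with every element of `S`, then the minimal
polynomial of `p` is a power of a single monic irreducible polynomial; in particular `p`
is either invertible or nilpotent. -/
theorem minpoly_primePower_of_selfAdjoint_commuting
    (V : Type*) [AddCommGroup V] [Module ℝ V] [FiniteDimensional ℝ V]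
    (g : V →ₗ[ℝ] V →ₗ[ℝ] ℝ)
    (hg_symm : ∀ x y, g x y = g y x)
    (hg_nondeg : ∀ x, (∀ y, g x y = 0) → x = 0)
    (S : Set (Module.End ℝ V))
    (hS_indec : ¬ ∃ W₁ W₂ : Submodule ℝ V, W₁ ≠ ⊥ ∧ W₂ ≠ ⊥ ∧ IsCompl W₁ W₂ ∧
      (∀ u ∈ W₁, ∀ v ∈ W₂, g u v = 0) ∧
      (∀ T ∈ S, ∀ w ∈ W₁, T w ∈ W₁) ∧ (∀ T ∈ S, ∀ w ∈ W₂, T w ∈ W₂))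
    (p : Module.End ℝ V)
    (hp_selfadj : ∀ x y, g (p x) y = g x (p y))
    (hp_comm : ∀ T ∈ S, p * T = T * p) :
    (∃ q : Polynomial ℝ, q.Monic ∧ Irreducible q ∧ ∃ k : ℕ, minpoly ℝ p = q ^ k) ∧
    (IsUnit p ∨ IsNilpotent p) := by
  have hint : IsIntegral ℝ p := Algebra.IsIntegral.isIntegral p
  have hmon := minpoly.monic hint
  have hinv : ∀ a : Polynomial ℝ, ∀ T ∈ S, ∀ w ∈ LinearMap.ker (Polynomial.aeval p a),
      T w ∈ LinearMap.ker (Polynomial.aeval p a) := by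
    intro a T hT w hw
    have hc : Commute (Polynomial.aeval p a) T := aux_comm p T (hp_comm T hT) a
    rw [LinearMap.mem_ker] at hw ⊢
    rw [← Module.End.mul_apply, hc.eq, Module.End.mul_apply, hw, map_zero]
  have hker : ∀ a b : Polynomial ℝ, a * b = minpoly ℝ p →
      LinearMap.ker (Polynomial.aeval p a) = ⊥ → IsUnit a := by
    intro a b hab ha
    have h0 : Polynomial.aeval p b = 0 := by
      ext x
      have : Polynomial.aeval p b x ∈ LinearMap.ker (Polynomial.aeval p a) := by
        rw [LinearMap.mem_ker, ← Module.End.mul_apply, ← map_mul, hab, minpoly.aeval]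
        rfl
      rw [ha] at this
      simpa using this
    obtain ⟨c, hc⟩ := minpoly.dvd ℝ p h0
    have hb : b ≠ 0 := by
      rintro rfl
      rw [mul_zero] at hab
      exact hmon.ne_zero hab.symm
    refine IsUnit.of_mul_eq_one c ?_
    apply mul_right_cancel₀ hb
    rw [one_mul]
    conv_rhs => rw [hc, ← hab]
    ring
  have key : ∀ a b : Polynomial ℝ, IsCoprime a b → a * b = minpoly ℝ p →
      IsUnit a ∨ IsUnit b := by
    intro a b hco hab
    by_contra! hcon
    apply hS_indec
    refine ⟨LinearMap.ker (Polynomial.aeval p a), LinearMap.ker (Polynomial.aeval p b),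
      fun h => hcon.1 (hker a b hab h), fun h => hcon.2 (hker b a (by rw [mul_comm, hab]) h),
      ⟨Polynomial.disjoint_ker_aeval_of_isCoprime p hco, ?_⟩, ?_, hinv a, hinv b⟩
    · rw [codisjoint_iff, Polynomial.sup_ker_aeval_eq_ker_aeval_mul_of_coprime p hco, hab,
        minpoly.aeval, LinearMap.ker_zero]
    · intro u hu v hv
      obtain ⟨c, d, hcd⟩ := hco
      rw [LinearMap.mem_ker] at hu hv
      have h1 : u = Polynomial.aeval p b (Polynomial.aeval p d u) := by
        have := congrArg (fun f => Polynomial.aeval p f u) hcd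
        simp only [map_add, map_mul, map_one, LinearMap.add_apply, Module.End.mul_apply, hu,
          map_zero, zero_add, Module.End.one_apply] at this
        rw [← Module.End.mul_apply, ← map_mul, mul_comm, map_mul, Module.End.mul_apply, this]
      rw [h1, aux_aeval_selfadj g p hp_selfadj, hv, map_zero]
  have main : ∃ q : Polynomial ℝ, q.Monic ∧ Irreducible q ∧ ∃ k : ℕ, minpoly ℝ p = q ^ k := by
    by_cases hu : IsUnit (minpoly ℝ p)
    · exact ⟨Polynomial.X, Polynomial.monic_X, Polynomial.irreducible_X, 0, by
        rw [pow_zero]; exact hmon.eq_one_of_isUnit hu⟩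
    · obtain ⟨q, hqm, hqi, hqd⟩ := Polynomial.exists_monic_irreducible_factor _ hu
      have hf : FiniteMultiplicity q (minpoly ℝ p) :=
        FiniteMultiplicity.of_not_isUnit hqi.not_isUnit hmon.ne_zero
      obtain ⟨c, hc, hnd⟩ := hf.exists_eq_pow_mul_and_not_dvd
      refine ⟨q, hqm, hqi, multiplicity q (minpoly ℝ p), ?_⟩
      set n := multiplicity q (minpoly ℝ p) with hn
      have hn0 : n ≠ 0 := by
        intro h0
        rw [h0, pow_zero, one_mul] at hc
        exact hnd (hc ▸ hqd)
      have hco : IsCoprime (q ^ n) c := (hqi.coprime_iff_not_dvd.2 hnd).pow_left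
      rcases key _ _ hco hc.symm with h | h
      · exact absurd ((isUnit_pow_iff hn0).1 h) hqi.not_isUnit
      · have hcm : c.Monic := (hqm.pow n).of_mul_monic_left (hc ▸ hmon)
        rw [hcm.eq_one_of_isUnit h, mul_one] at hc
        exact hc
  refine ⟨main, ?_⟩
  obtain ⟨q, hqm, hqi, k, hk⟩ := main
  by_cases hd : q ∣ Polynomial.X
  · right
    refine ⟨k, ?_⟩
    have h1 : minpoly ℝ p ∣ Polynomial.X ^ k := hk ▸ pow_dvd_pow_of_dvd hd k
    simpa using (minpoly.dvd_iff.1 h1)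
  · left
    have hco : IsCoprime (q ^ k) Polynomial.X := (hqi.coprime_iff_not_dvd.2 hd).pow_left
    obtain ⟨c, d, hcd⟩ := hco
    have h1 := congrArg (Polynomial.aeval p) hcd
    rw [← hk] at h1
    simp only [map_add, map_mul, minpoly.aeval, mul_zero, zero_add, Polynomial.aeval_X,
      map_one] at h1
    have h2 : p * Polynomial.aeval p d = 1 := by
      rw [← h1]
      have := congrArg (Polynomial.aeval p) (mul_comm Polynomial.X d)
      simpa using this
    exact ⟨⟨p, _, h2, h1⟩, rfl⟩
end

section
/- Let A be a finite-dimensional unital associative algebra over the reals, let U be an element of A and let N belong to the Jacobson radical of A. Then a monic irreducible real polynomial divides the minimal polynomial of U over R if and only if it divides the minimal polynomial of U + N over R; that is, the minimal polynomials of U and of U + N have exactly the same irreducible factors. -/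
theorem aeval_sub_mem_aux {A : Type*} [Ring A] [Algebra ℝ A] (J : Ideal A) [J.IsTwoSided]
    (U V : A) (h : U - V ∈ J) (p : Polynomial ℝ) :
    Polynomial.aeval U p - Polynomial.aeval V p ∈ J := by
  induction p using Polynomial.induction_on' with
  | add p q hp hq =>
    have e := J.add_mem hp hq
    rw [map_add, map_add]
    convert e using 1
    abel
  | monomial n a =>
    rw [Polynomial.aeval_monomial, Polynomial.aeval_monomial, ← mul_sub]
    apply J.mul_mem_left
    induction n with
    | zero => simp
    | succ n ih =>
      have e : U ^ (n + 1) - V ^ (n + 1) = U ^ n * (U - V) + (U ^ n - V ^ n) * V := by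
        rw [pow_succ, pow_succ]; noncomm_ring
      rw [e]
      exact J.add_mem (J.mul_mem_left _ h) (J.mul_mem_right _ ih)

theorem dvd_aux {A : Type*} [Ring A] [Algebra ℝ A] [FiniteDimensional ℝ A]
    (U V : A) (h : U - V ∈ Ideal.jacobson (⊥ : Ideal A)) (q : Polynomial ℝ)
    (hq : Irreducible q) (hd : q ∣ minpoly ℝ U) : q ∣ minpoly ℝ V := by
  have : IsArtinianRing A := IsArtinianRing.of_finite ℝ A
  obtain ⟨k, hk⟩ := IsArtinianRing.isNilpotent_jacobson_bot (R := A)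
  have h1 := aeval_sub_mem_aux _ U V h (minpoly ℝ V)
  rw [minpoly.aeval, sub_zero] at h1
  have h2 := Ideal.pow_mem_pow h1 k
  rw [hk, ← map_pow] at h2
  have h3 : Polynomial.aeval U (minpoly ℝ V ^ k) = 0 := by simpa using h2
  exact hq.prime.dvd_of_dvd_pow (hd.trans (minpoly.dvd ℝ U h3))

/-- In a finite-dimensional unital associative real algebra `A`, if `N`
lies in the Jacobson radical of `A`, then the minimal polynomials over `ℝ` of `U` and of
`U + N` have exactly the same monic irreducible factors. -/
theorem minpoly_same_irreducible_factors_of_radical_perturbation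
    (A : Type*) [Ring A] [Algebra ℝ A] [FiniteDimensional ℝ A]
    (U N : A) (hN : N ∈ Ideal.jacobson (⊥ : Ideal A)) :
    ∀ q : Polynomial ℝ, q.Monic → Irreducible q →
      (q ∣ minpoly ℝ U ↔ q ∣ minpoly ℝ (U + N)) := by
  intro q _ hq
  constructor
  · refine dvd_aux U (U + N) ?_ q hq
    simpa using neg_mem hN
  · refine dvd_aux (U + N) U ?_ q hq
    simpa using hN
end

section
/- Let R be an algebraic curvature tensor on (V,g) and let U be a g-self-adjoint endomorphism of V commuting with every curvature operator R(x,y). Then for all x, y, z in V one has R(Ux,y)z = R(x,Uy)z = R(x,y)(Uz). -/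
/-- If `R` is an algebraic curvature tensor on `(V, g)` and `U` is a
`g`-self-adjoint endomorphism of `V` commuting with every curvature operator `R x y`,
then `R (U x) y z = R x (U y) z = R x y (U z)` for all `x y z`. -/
theorem parallel_selfAdjoint_curvature_swap
    (V : Type*) [AddCommGroup V] [Module ℝ V] [FiniteDimensional ℝ V]
    (g : V →ₗ[ℝ] V →ₗ[ℝ] ℝ)
    (hg_symm : ∀ x y, g x y = g y x)
    (hg_nondeg : ∀ x, (∀ y, g x y = 0) → x = 0)
    (R : V →ₗ[ℝ] V →ₗ[ℝ] Module.End ℝ V)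
    (hR_anti : ∀ x y, R x y = - R y x)
    (hR_skew : ∀ x y u v, g (R x y u) v = - g u (R x y v))
    (hR_bianchi : ∀ x y z, R x y z + R y z x + R z x y = 0)
    (U : Module.End ℝ V)
    (hU_selfadj : ∀ x y, g (U x) y = g x (U y))
    (hU_comm : ∀ x y, U * R x y = R x y * U) :
    ∀ x y z, R (U x) y z = R x (U y) z ∧ R x (U y) z = R x y (U z) := by
  have anti : ∀ x y z w, g (R x y z) w = - g (R y x z) w := by
    intro x y z w
    rw [hR_anti x y]; simp
  have skew : ∀ x y z w, g (R x y z) w = - g (R x y w) z := by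
    intro x y z w
    rw [hR_skew, hg_symm]
  have bian : ∀ x y z w, g (R x y z) w + g (R y z x) w + g (R z x y) w = 0 := by
    intro x y z w
    have h := congrArg (fun v => g v w) (hR_bianchi x y z)
    simpa using h
  have pair : ∀ x y z w, g (R x y z) w = g (R z w x) y := by
    intro x y z w
    linarith [bian x y z w, bian y z w x, bian z w x y, bian w x y z,
      skew x y z w, skew y z x w, skew z x y w, skew y z w x, skew z w y x, skew w y z x,
      skew z w x y, skew w x z y, skew x z w y, skew w x y z, skew x y w z, skew y w x z,
      anti x z w y, anti x z y w, anti y w x z, anti y w z x]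
  have comm : ∀ x y z, U (R x y z) = R x y (U z) := by
    intro x y z
    exact congrArg (fun f : Module.End ℝ V => f z) (hU_comm x y)
  have commg : ∀ x y z w, g (R x y (U z)) w = g (R x y z) (U w) := by
    intro x y z w
    rw [← comm, hU_selfadj]
  have swap : ∀ x y z w, g (R (U x) y z) w = g (R x (U y) z) w := by
    intro x y z w
    rw [pair, commg, ← pair]
  have csum : ∀ x y z w,
      g (R x y (U z)) w + g (R y z (U x)) w + g (R z x (U y)) w = 0 := by
    intro x y z w
    rw [commg, commg, commg]
    exact bian x y z (U w)
  have ext' : ∀ a b : V, (∀ w, g a w = g b w) → a = b := by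
    intro a b h
    apply sub_eq_zero.mp
    apply hg_nondeg
    intro w
    simp [h w]
  intro x y z
  refine ⟨ext' _ _ (swap x y z), ext' _ _ fun w => ?_⟩
  linarith [csum x y z w, bian x y (U z) w, bian y z (U x) w, bian z x (U y) w,
    swap x y z w, swap y z x w, swap z x y w]
end

section
/- Let R be an algebraic curvature tensor on (V,g), and let U and W be endomorphisms of V each commuting with every curvature operator R(x,y). If U is g-self-adjoint, then R(x,y) composed with (U∘W - W∘U) is the zero endomorphism, for all x, y in V. -/
/-- If `R` is an algebraic curvature tensor on `(V, g)` and `U`, `W` are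
endomorphisms commuting with every curvature operator `R x y`, with `U` `g`-self-adjoint,
then `R x y ∘ (U ∘ W - W ∘ U) = 0` for all `x, y`. -/
theorem curvature_annihilates_commutator
    (V : Type*) [AddCommGroup V] [Module ℝ V] [FiniteDimensional ℝ V]
    (g : V →ₗ[ℝ] V →ₗ[ℝ] ℝ)
    (hg_symm : ∀ x y, g x y = g y x)
    (hg_nondeg : ∀ x, (∀ y, g x y = 0) → x = 0)
    (R : V →ₗ[ℝ] V →ₗ[ℝ] Module.End ℝ V)
    (hR_anti : ∀ x y, R x y = - R y x)
    (hR_skew : ∀ x y u v, g (R x y u) v = - g u (R x y v))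
    (hR_bianchi : ∀ x y z, R x y z + R y z x + R z x y = 0)
    (U W : Module.End ℝ V)
    (hU_selfadj : ∀ x y, g (U x) y = g x (U y))
    (hU_comm : ∀ x y, U * R x y = R x y * U)
    (hW_comm : ∀ x y, W * R x y = R x y * W) :
    ∀ x y, R x y * (U * W - W * U) = 0 := by
  have anti : ∀ x y z, R x y z = - R y x z := fun x y z => by
    rw [hR_anti x y]; rfl
  have hU : ∀ x y z, U (R x y z) = R x y (U z) := fun x y z =>
    LinearMap.congr_fun (hU_comm x y) z
  have hW : ∀ x y z, W (R x y z) = R x y (W z) := fun x y z =>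
    LinearMap.congr_fun (hW_comm x y) z
  have a1 : ∀ x y z w, g (R x y z) w = - g (R y x z) w := fun x y z w => by
    rw [anti x y z]; simp
  have a2 : ∀ x y z w, g (R x y z) w = - g (R x y w) z := fun x y z w => by
    rw [hR_skew, hg_symm]
  have b : ∀ x y z w, g (R x y z) w + g (R y z x) w + g (R z x y) w = 0 :=
    fun x y z w => by
      have := congrArg (fun v => g v w) (hR_bianchi x y z)
      simpa using this
  have pair : ∀ x y z w, g (R x y z) w = g (R z w x) y := fun x y z w => by
    linarith [b x y z w, b y z w x, b z w x y, b w x y z,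
      a2 x y z w, a2 y z x w, a2 z x y w, a1 z x w y, a2 z w y x, a2 w x z y,
      a1 w y z x, a1 w y x z, a2 y w z x, a1 x z y w, a1 x z w y, a2 w y z x, a2 x z w y,
      a2 w x y z, a2 z w x y]
  have mv : ∀ x y z, R (U x) y z = R x (U y) z := fun x y z => by
    apply sub_eq_zero.mp
    apply hg_nondeg
    intro w
    rw [map_sub, LinearMap.sub_apply, pair (U x) y z w, pair x (U y) z w, ← hU, hU_selfadj,
      sub_self]
  have T1 : ∀ x y z, (R (U x) y z - U (R x y z)) + (R (U z) x y - U (R z x y)) = 0 := by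
    intro x y z
    have h1 := hR_bianchi (U x) y z
    have h2 := congrArg U (hR_bianchi x y z)
    simp only [map_add, map_zero] at h2
    rw [← hU, ← mv z x y] at h1
    have : (R (U x) y z - U (R x y z)) + (R (U z) x y - U (R z x y)) =
      (R (U x) y z + U (R y z x) + R (U z) x y) -
      (U (R x y z) + U (R y z x) + U (R z x y)) := by abel
    rw [this, h1, h2, sub_zero]
  have T : ∀ x y z, R (U x) y z = U (R x y z) := by
    intro x y z
    have h1 := T1 x y z
    have h2 := T1 z x y
    have h3 := T1 y z x
    apply sub_eq_zero.mp
    have h : (2 : ℝ) • (R (U x) y z - U (R x y z)) = 0 := by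
      linear_combination (norm := module) h1 - h2 + h3
    exact (smul_eq_zero.mp h).resolve_left two_ne_zero
  intro x y
  ext z
  simp only [Module.End.mul_apply, LinearMap.sub_apply, map_sub, LinearMap.zero_apply]
  rw [← hU, ← T, ← hW, ← hW, ← hU, T, sub_self]
end

section
/- Let R be an algebraic curvature tensor on (V,g), and let U and W be endomorphisms of V each commuting with every curvature operator R(x,y), with U g-self-adjoint. Then the image of U∘W - W∘U is contained in the intersection over all x,y in V of the kernels of R(x,y). In particular, if the intersection of the kernels of all the operators R(x,y) is zero, then U∘W = W∘U; hence in that case every g-self-adjoint endomorphism commuting with all curvature operators lies in the center of the commutant algebra of the set of curvature operators. -/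
/-- With `R` an algebraic curvature tensor on `(V, g)` and `U`, `W`
endomorphisms commuting with every curvature operator, `U` `g`-self-adjoint: the image of
`U ∘ W - W ∘ U` lies in `⋂_{x,y} ker (R x y)`; in particular, if that intersection is
trivial then `U ∘ W = W ∘ U`, and indeed every `g`-self-adjoint endomorphism commuting
with all curvature operators is then central in the commutant of the curvature operators. -/
theorem commutator_range_in_curvature_kernel
    (V : Type*) [AddCommGroup V] [Module ℝ V] [FiniteDimensional ℝ V]
    (g : V →ₗ[ℝ] V →ₗ[ℝ] ℝ)
    (hg_symm : ∀ x y, g x y = g y x)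
    (hg_nondeg : ∀ x, (∀ y, g x y = 0) → x = 0)
    (R : V →ₗ[ℝ] V →ₗ[ℝ] Module.End ℝ V)
    (hR_anti : ∀ x y, R x y = - R y x)
    (hR_skew : ∀ x y u v, g (R x y u) v = - g u (R x y v))
    (hR_bianchi : ∀ x y z, R x y z + R y z x + R z x y = 0)
    (U W : Module.End ℝ V)
    (hU_selfadj : ∀ x y, g (U x) y = g x (U y))
    (hU_comm : ∀ x y, U * R x y = R x y * U)
    (hW_comm : ∀ x y, W * R x y = R x y * W) :
    (LinearMap.range (U * W - W * U) ≤ ⨅ (x : V) (y : V), LinearMap.ker (R x y)) ∧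
    ((⨅ (x : V) (y : V), LinearMap.ker (R x y)) = ⊥ → U * W = W * U) ∧
    ((⨅ (x : V) (y : V), LinearMap.ker (R x y)) = ⊥ →
      ∀ W' : Module.End ℝ V, (∀ x y, W' * R x y = R x y * W') → U * W' = W' * U) := by
  have UR : ∀ x y z, U (R x y z) = R x y (U z) := fun x y z => LinearMap.congr_fun (hU_comm x y) z
  have anti : ∀ x y z, R x y z = - R y x z := fun x y z => by
    rw [hR_anti x y]; rfl
  have a1 : ∀ x y z w, g (R x y z) w = - g (R y x z) w := fun x y z w => by
    rw [anti x y z]; simp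
  have a2 : ∀ x y z w, g (R x y z) w = - g (R x y w) z := fun x y z w => by
    rw [hR_skew, hg_symm]
  have b : ∀ x y z w, g (R x y z) w + g (R y z x) w + g (R z x y) w = 0 := fun x y z w => by
    have h := congrArg (fun v => g v w) (hR_bianchi x y z)
    simpa using h
  have pair : ∀ x y z w, g (R x y z) w = g (R z w x) y := fun x y z w => by
    linarith [b x y z w, b y z w x, b z w x y, b w x y z,
      a2 x y z w, a2 y z x w, a2 z x y w, a2 y z w x, a2 z w y x, a2 w y z x,
      a2 z w x y, a2 w x z y, a2 x z w y, a2 w x y z, a2 x y w z, a2 y w x z,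
      a1 z x y w, a1 w y z x, a1 x z w y, a1 y w x z, a1 z x w y, a1 w y x z]
  have shift : ∀ x y z, R (U x) y z = R x (U y) z := fun x y z => by
    rw [← sub_eq_zero]
    apply hg_nondeg
    intro w
    have : g (R (U x) y z) w = g (R x (U y) z) w := by
      rw [pair, ← UR, hU_selfadj, ← pair]
    simp [this]
  have key : ∀ x y z, R (U x) y z = U (R x y z) := fun x y z => by
    have h1 := hR_bianchi (U x) y z
    have h2 := hR_bianchi (U y) z x
    have h3 := hR_bianchi (U z) x y
    have h0 := congrArg U (hR_bianchi x y z)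
    simp only [map_add, map_zero] at h0
    rw [← shift, ← UR] at h1 h2 h3
    have h4 : (2:ℝ) • (R (U x) y z - U (R x y z)) = 0 := by
      linear_combination (norm := module) h1 + h2 - h3 - h0
    rcases smul_eq_zero.mp h4 with h | h
    · norm_num at h
    · exact sub_eq_zero.mp h
  have main : ∀ W' : Module.End ℝ V, (∀ x y, W' * R x y = R x y * W') →
      LinearMap.range (U * W' - W' * U) ≤ ⨅ (x : V) (y : V), LinearMap.ker (R x y) := by
    intro W' hW'
    have WR : ∀ x y z, W' (R x y z) = R x y (W' z) :=
      fun x y z => LinearMap.congr_fun (hW' x y) z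
    rintro _ ⟨v, rfl⟩
    simp only [Submodule.mem_iInf, LinearMap.mem_ker]
    intro x y
    have h := WR (U x) y v
    rw [key, key] at h
    simp only [LinearMap.sub_apply, Module.End.mul_apply, map_sub]
    rw [← UR, ← WR x y (U v), ← UR, h, sub_self]
  have main2 : (⨅ (x : V) (y : V), LinearMap.ker (R x y)) = ⊥ →
      ∀ W' : Module.End ℝ V, (∀ x y, W' * R x y = R x y * W') → U * W' = W' * U := by
    intro hk W' hW'
    have h := main W' hW'
    rw [hk, le_bot_iff, LinearMap.range_eq_bot] at h
    exact sub_eq_zero.mp h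
  exact ⟨main W hW_comm, fun hk => main2 hk W hW_comm, main2⟩
end

section
/- Let R be an algebraic curvature tensor on (V,g), and let U and W be endomorphisms of V each commuting with every curvature operator R(x,y), with U g-self-adjoint. If U∘W - W∘U is invertible, then R is identically zero, i.e. R(x,y) = 0 for all x,y in V. -/
/-- With `R` an algebraic curvature tensor on `(V, g)` and `U`, `W`
endomorphisms commuting with every curvature operator, `U` `g`-self-adjoint: if
`U ∘ W - W ∘ U` is invertible then `R` vanishes identically. -/
theorem invertible_commutator_implies_flat
    (V : Type*) [AddCommGroup V] [Module ℝ V] [FiniteDimensional ℝ V]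
    (g : V →ₗ[ℝ] V →ₗ[ℝ] ℝ)
    (hg_symm : ∀ x y, g x y = g y x)
    (hg_nondeg : ∀ x, (∀ y, g x y = 0) → x = 0)
    (R : V →ₗ[ℝ] V →ₗ[ℝ] Module.End ℝ V)
    (hR_anti : ∀ x y, R x y = - R y x)
    (hR_skew : ∀ x y u v, g (R x y u) v = - g u (R x y v))
    (hR_bianchi : ∀ x y z, R x y z + R y z x + R z x y = 0)
    (U W : Module.End ℝ V)
    (hU_selfadj : ∀ x y, g (U x) y = g x (U y))
    (hU_comm : ∀ x y, U * R x y = R x y * U)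
    (hW_comm : ∀ x y, W * R x y = R x y * W)
    (h_inv : IsUnit (U * W - W * U)) :
    ∀ x y, R x y = 0 := by
  have hA : ∀ x y z w, g (R x y z) w = - g (R y x z) w := by
    intro x y z w
    rw [hR_anti x y]; simp
  have hS : ∀ x y z w, g (R x y z) w = - g (R x y w) z := by
    intro x y z w
    rw [hR_skew, hg_symm]
  have hB : ∀ x y z w, g (R x y z) w + g (R y z x) w + g (R z x y) w = 0 := by
    intro x y z w
    have := congrArg (fun v => g v w) (hR_bianchi x y z)
    simpa using this
  have hP : ∀ x y z w, g (R x y z) w = g (R z w x) y := by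
    intro x y z w
    have b1 := hB x y z w
    have b2 := hB y z w x
    have b3 := hB z w x y
    have b4 := hB w x y z
    have s1 := hS x y z w
    have s2 := hS y z x w
    have s3 := hS z w x y
    have s4 := hS w x y z
    have s5 := hS z x y w
    have s6 := hS w y z x
    have a5 := hA z x w y
    have a6 := hA w y x z
    linarith
  have hUa : ∀ x y z, U (R x y z) = R x y (U z) := by
    intro x y z
    exact LinearMap.congr_fun (hU_comm x y) z
  have hE : ∀ x y z, R (U x) y z = R x (U y) z := by
    intro x y z
    rw [← sub_eq_zero]
    apply hg_nondeg
    intro w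
    rw [map_sub, LinearMap.sub_apply, hP (U x), hP x, ← hUa, hU_selfadj, sub_self]
  have hT : ∀ x y z, R (U x) y z = - R (U y) x z := by
    intro x y z
    rw [hE, hR_anti]; simp
  have hT2 : ∀ x y z, R (U x) y z + R (U z) x y = - U (R y z x) := by
    intro x y z
    have h := hR_bianchi (U x) y z
    have h2 : R z (U x) y = R (U z) x y := (hE z x y).symm
    rw [h2, ← hUa] at h
    rw [eq_neg_iff_add_eq_zero, ← h]; abel
  have hM : ∀ x y z, R (U x) y z = U (R x y z) := by
    intro x y z
    have e1 := hT2 x y z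
    have e2 := hT2 y z x
    have e3 := hT2 z x y
    have e4 : U (R x y z) + U (R y z x) + U (R z x y) = 0 := by
      rw [← map_add, ← map_add, hR_bianchi, map_zero]
    have h2 : (2 : ℝ) • (R (U x) y z - U (R x y z)) = 0 := by
      linear_combination (norm := module) e1 + e2 - e3 - e4
    have := (smul_eq_zero.mp h2).resolve_left two_ne_zero
    exact sub_eq_zero.mp this
  have hM' : ∀ x y, R (U x) y = U * R x y := fun x y => LinearMap.ext (hM x y)
  intro x y
  have key : R x y * (U * W - W * U) = 0 := by
    have h1 : R x y * (W * U) = R x y * (U * W) := by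
      calc R x y * (W * U) = W * (R x y * U) := by rw [← mul_assoc, ← hW_comm, mul_assoc]
        _ = W * R (U x) y := by rw [hM', hU_comm]
        _ = R (U x) y * W := hW_comm _ _
        _ = R x y * (U * W) := by rw [hM', hU_comm, mul_assoc]
    rw [mul_sub, h1, sub_self]
  exact (h_inv.mul_left_eq_zero).mp key
end

section
/- Suppose dim V ≥ 2 and let S be a set of g-skew-adjoint endomorphisms of V whose action on V is orthogonally indecomposable. Then the subspace E0, defined as the intersection of the kernels of all elements of S, is totally isotropic: g(u,v) = 0 for all u, v in E0. -/
/-- If `dim V ≥ 2` and `S` is a set of `g`-skew-adjoint endomorphisms of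
`V` whose action is orthogonally indecomposable, then `E₀ = ⋂_{T ∈ S} ker T` is totally
isotropic for `g`. -/
theorem common_kernel_totally_isotropic
    (V : Type*) [AddCommGroup V] [Module ℝ V] [FiniteDimensional ℝ V]
    (g : V →ₗ[ℝ] V →ₗ[ℝ] ℝ)
    (hg_symm : ∀ x y, g x y = g y x)
    (hg_nondeg : ∀ x, (∀ y, g x y = 0) → x = 0)
    (hdim : 2 ≤ Module.finrank ℝ V)
    (S : Set (Module.End ℝ V))
    (hS_skew : ∀ T ∈ S, ∀ x y, g (T x) y = - g x (T y))
    (hS_indec : ¬ ∃ W₁ W₂ : Submodule ℝ V, W₁ ≠ ⊥ ∧ W₂ ≠ ⊥ ∧ IsCompl W₁ W₂ ∧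
      (∀ u ∈ W₁, ∀ v ∈ W₂, g u v = 0) ∧
      (∀ T ∈ S, ∀ w ∈ W₁, T w ∈ W₁) ∧ (∀ T ∈ S, ∀ w ∈ W₂, T w ∈ W₂)) :
    ∀ u v : V, (∀ T ∈ S, T u = 0) → (∀ T ∈ S, T v = 0) → g u v = 0 := by
  have key : ∀ w : V, (∀ T ∈ S, T w = 0) → g w w = 0 := by
    intro w hw
    by_contra hne
    have hc : IsCompl (Submodule.span ℝ {w}) (LinearMap.ker (g w)) := by
      have h := LinearMap.BilinForm.isCompl_span_singleton_orthogonal (B := g) hne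
      rwa [LinearMap.BilinForm.orthogonal_span_singleton_eq_toLin_ker] at h
    apply hS_indec
    refine ⟨_, _, ?_, ?_, hc, ?_, ?_, ?_⟩
    · rw [Ne, Submodule.span_singleton_eq_bot]
      rintro rfl
      simp at hne
    · intro hb
      have h1 := Submodule.finrank_add_eq_of_isCompl hc
      rw [hb, finrank_bot] at h1
      have h2 := finrank_span_le_card (R := ℝ) ({w} : Set V)
      simp at h2
      omega
    · intro u hu v hv
      obtain ⟨a, rfl⟩ := Submodule.mem_span_singleton.1 hu
      have hv' : g w v = 0 := hv
      simp [hv']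
    · intro T hT u hu
      obtain ⟨a, rfl⟩ := Submodule.mem_span_singleton.1 hu
      simp [hw T hT]
    · intro T hT v _
      have h := hS_skew T hT w v
      rw [hw T hT] at h
      rw [LinearMap.mem_ker]
      simp at h
      linarith
  intro u v hu hv
  have h := key (u + v) (fun T hT => by simp [hu T hT, hv T hT])
  have h1 := key u hu
  have h2 := key v hv
  have h3 := hg_symm u v
  simp only [map_add, LinearMap.add_apply] at h
  linarith
end

section
/- Let S be a set of g-skew-adjoint endomorphisms of V and let E0 be the intersection of the kernels of all elements of S. Assume E0 is totally isotropic (g vanishes on E0). If N and N' are endomorphisms of V, each commuting with every element of S, whose images are both contained in E0, then N'∘N = 0. -/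
/-- Let `S` be a set of `g`-skew-adjoint endomorphisms of `V` and
`E₀ = ⋂_{T ∈ S} ker T`, assumed totally isotropic.  If `N` and `N'` commute with every
element of `S` and their images are contained in `E₀`, then `N' ∘ N = 0`. -/
theorem product_of_radical_endomorphisms_vanishes
    (V : Type*) [AddCommGroup V] [Module ℝ V] [FiniteDimensional ℝ V]
    (g : V →ₗ[ℝ] V →ₗ[ℝ] ℝ)
    (hg_symm : ∀ x y, g x y = g y x)
    (hg_nondeg : ∀ x, (∀ y, g x y = 0) → x = 0)
    (S : Set (Module.End ℝ V))
    (hS_skew : ∀ T ∈ S, ∀ x y, g (T x) y = - g x (T y))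
    (hE0_isotropic : ∀ u v : V, (∀ T ∈ S, T u = 0) → (∀ T ∈ S, T v = 0) → g u v = 0)
    (N N' : Module.End ℝ V)
    (hN_comm : ∀ T ∈ S, N * T = T * N)
    (hN'_comm : ∀ T ∈ S, N' * T = T * N')
    (hN_range : ∀ v : V, ∀ T ∈ S, T (N v) = 0)
    (hN'_range : ∀ v : V, ∀ T ∈ S, T (N' v) = 0) :
    N' * N = 0 := by
  have hinj : Function.Injective g := by
    rw [← LinearMap.ker_eq_bot, LinearMap.ker_eq_bot']
    intro x hx
    exact hg_nondeg x (fun y => by rw [hx]; rfl)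
  have hsurj : Function.Surjective g :=
    (LinearMap.injective_iff_surjective_of_finrank_eq_finrank
      (Subspace.dual_finrank_eq (K := ℝ) (V := V)).symm).1 hinj
  ext x
  apply hg_nondeg
  intro y
  obtain ⟨w, hw⟩ := hsurj ((g y).comp N')
  have hw' : ∀ z, g w z = g y (N' z) := fun z => by rw [hw]; rfl
  have hwE : ∀ T ∈ S, T w = 0 := by
    intro T hT
    apply hg_nondeg
    intro z
    have h1 : N' (T z) = T (N' z) := LinearMap.congr_fun (hN'_comm T hT) z
    rw [hS_skew T hT, hw', h1, hN'_range z T hT]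
    simp
  have h := hE0_isotropic w (N x) hwE (hN_range x)
  rw [hw'] at h
  rw [hg_symm]
  exact h
end

section
/- Let A be a subalgebra of End(V) that is self-adjoint (stable under the g-adjoint U -> U*). Then for every U in A and every N in the Jacobson radical of A, the trace of U*∘N is zero; in other words, the Jacobson radical of A is contained in the kernel of the bilinear form (U,W) -> tr(U*∘W) on A. -/
/-- Let `A` be a self-adjoint subalgebra of `End(V)` (stable under the
`g`-adjoint `adj`).  Then for every `U ∈ A` and every `N` in the Jacobson radical of `A`,
`tr (U* ∘ N) = 0`: the radical lies in the kernel of the form `(U, W) ↦ tr (U* ∘ W)`. -/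
theorem radical_in_kernel_of_trace_form
    (V : Type*) [AddCommGroup V] [Module ℝ V] [FiniteDimensional ℝ V]
    (g : V →ₗ[ℝ] V →ₗ[ℝ] ℝ)
    (hg_symm : ∀ x y, g x y = g y x)
    (hg_nondeg : ∀ x, (∀ y, g x y = 0) → x = 0)
    (adj : Module.End ℝ V → Module.End ℝ V)
    (hadj : ∀ T : Module.End ℝ V, ∀ x y, g (T x) y = g x (adj T y))
    (A : Subalgebra ℝ (Module.End ℝ V))
    (hA_selfadj : ∀ T ∈ A, adj T ∈ A) :
    ∀ U N : A, N ∈ Ideal.jacobson (⊥ : Ideal A) →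
      LinearMap.trace ℝ V (adj (U : Module.End ℝ V) * (N : Module.End ℝ V)) = 0 := by
  intro U N hN
  have : IsArtinianRing A := IsArtinianRing.of_finite ℝ A
  have hM : (⟨adj U, hA_selfadj _ U.2⟩ : A) * N ∈ Ideal.jacobson (⊥ : Ideal A) :=
    Ideal.mul_mem_left _ _ hN
  obtain ⟨n, hn⟩ := IsArtinianRing.isNilpotent_jacobson_bot (R := A)
  have h0 : ((⟨adj U, hA_selfadj _ U.2⟩ : A) * N) ^ n = 0 := by
    have := Ideal.pow_mem_pow hM n
    rw [hn] at this
    simpa using this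
  have h1 : IsNilpotent (adj (U : Module.End ℝ V) * (N : Module.End ℝ V)) :=
    ⟨n, by simpa using congrArg (Subtype.val) h0⟩
  exact (LinearMap.isNilpotent_trace_of_isNilpotent h1).eq_zero
end

section
/- Let R be an algebraic curvature tensor on (V,g) and let N be a g-self-adjoint nilpotent endomorphism of V commuting with every curvature operator R(x,y). Then ric(a,Nb) = 0 for all a, b in V; that is, the image of N is contained in the kernel of the Ricci form, so if N ≠ 0 the Ricci form is degenerate. -/
/-- For an algebraic curvature tensor `R` on `(V, g)` and a
`g`-self-adjoint nilpotent endomorphism `N` commuting with every curvature operator,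
`ric (a, N b) = 0` for all `a, b` (so the image of `N` lies in the kernel of the Ricci
form, which is therefore degenerate when `N ≠ 0`).  Here `ric a b = tr (x ↦ R a x b)`. -/
theorem ricci_degenerate_of_selfAdjoint_nilpotent
    (V : Type*) [AddCommGroup V] [Module ℝ V] [FiniteDimensional ℝ V]
    (g : V →ₗ[ℝ] V →ₗ[ℝ] ℝ)
    (hg_symm : ∀ x y, g x y = g y x)
    (hg_nondeg : ∀ x, (∀ y, g x y = 0) → x = 0)
    (R : V →ₗ[ℝ] V →ₗ[ℝ] Module.End ℝ V)
    (hR_anti : ∀ x y, R x y = - R y x)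
    (hR_skew : ∀ x y u v, g (R x y u) v = - g u (R x y v))
    (hR_bianchi : ∀ x y z, R x y z + R y z x + R z x y = 0)
    (N : Module.End ℝ V)
    (hN_selfadj : ∀ x y, g (N x) y = g x (N y))
    (hN_nilpotent : IsNilpotent N)
    (hN_comm : ∀ x y, N * R x y = R x y * N) :
    (∀ a b : V, LinearMap.trace ℝ V ((R a).flip (N b)) = 0) ∧
    (N ≠ 0 → ∃ v : V, v ≠ 0 ∧ ∀ a : V, LinearMap.trace ℝ V ((R a).flip v) = 0) := by
  have anti : ∀ x y u, R x y u = - R y x u := fun x y u => by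
    rw [hR_anti x y]; rfl
  have comm : ∀ x y u, N (R x y u) = R x y (N u) := fun x y u => by
    have := congrArg (fun f : Module.End ℝ V => f u) (hN_comm x y)
    simpa using this
  have ant4 : ∀ x y u v, g (R x y u) v = - g (R y x u) v := fun x y u v => by
    rw [anti x y u]; simp
  have sk4 : ∀ x y u v, g (R x y u) v = - g (R x y v) u := fun x y u v => by
    rw [hR_skew, hg_symm]
  have bi4 : ∀ x y z v, g (R x y z) v + g (R y z x) v + g (R z x y) v = 0 := fun x y z v => by
    rw [← LinearMap.add_apply, ← LinearMap.add_apply, ← map_add, ← map_add, hR_bianchi]; simp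
  have pair : ∀ x y u v, g (R x y u) v = g (R u v x) y := fun x y u v => by
    linarith [bi4 x y u v, bi4 y u v x, bi4 u v x y, bi4 v x y u,
      sk4 x y u v, sk4 y u v x, sk4 u v x y, sk4 v x y u, sk4 x u v y, sk4 u x v y,
      sk4 y v x u, sk4 v y x u, sk4 y u x v, sk4 u x y v, sk4 v x u y, sk4 x y v u,
      sk4 u v y x, sk4 y v u x, ant4 x y u v, ant4 x y v u, ant4 u v x y, ant4 u v y x,
      ant4 y u x v, ant4 y u v x, ant4 v x y u, ant4 v x u y, ant4 u x y v, ant4 u x v y,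
      ant4 y v u x, ant4 y v x u]
  have slide : ∀ x y u, R (N x) y u = R x (N y) u := fun x y u => by
    rw [← sub_eq_zero]
    apply hg_nondeg
    intro v
    rw [map_sub, LinearMap.sub_apply, pair, pair x, ← comm, hN_selfadj, sub_self]
  have key : ∀ x y u, R (N x) y u = N (R x y u) := by
    have b1 : ∀ x y z, R (N x) y z + N (R y z x) + R (N z) x y = 0 := fun x y z => by
      rw [comm, slide z x y]; exact hR_bianchi _ _ _
    have b2 : ∀ x y z, N (R x y z) + N (R y z x) + N (R z x y) = 0 := fun x y z => by
      rw [← map_add, ← map_add, hR_bianchi, map_zero]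
    intro x y z
    have h1 := b1 x y z
    have h2 := b1 y z x
    have h3 := b1 z x y
    have h4 := b2 x y z
    have e : (2 : ℝ) • (R (N x) y z - N (R x y z)) = 
      (R (N x) y z + N (R y z x) + R (N z) x y) + (R (N y) z x + N (R z x y) + R (N x) y z)
      - (R (N z) x y + N (R x y z) + R (N y) z x)
      - (N (R x y z) + N (R y z x) + N (R z x y)) := by
      module
    rw [h1, h2, h3, h4] at e
    have := (smul_eq_zero.mp (e.trans (by simp))).resolve_left two_ne_zero
    exact sub_eq_zero.mp this
  have main : ∀ a b : V, LinearMap.trace ℝ V ((R a).flip (N b)) = 0 := by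
    intro a b
    have h1 : (R a).flip (N b) = N * (R a).flip b := by
      ext x
      simp [comm]
    have h2 : Commute N ((R a).flip b) := by
      ext x
      simp [← slide, key]
    rw [h1]
    exact (LinearMap.isNilpotent_trace_of_isNilpotent
      (h2.isNilpotent_mul_right hN_nilpotent)).eq_zero
  refine ⟨main, fun hN => ?_⟩
  obtain ⟨b, hb⟩ : ∃ b, N b ≠ 0 := by
    by_contra! h
    exact hN (LinearMap.ext h)
  exact ⟨N b, hb, fun a => main a b⟩
end

section
/- Let R be an algebraic curvature tensor on (V,g) and let U be a g-skew-adjoint endomorphism of V commuting with every curvature operator R(x,y). Then for all a, b in V: ric(a,Ub) = -ric(Ua,b), and ric(a,Ub) = (1/2) tr(U ∘ R(a,b)). -/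
theorem trace_eq_of_adj
    (V : Type*) [AddCommGroup V] [Module ℝ V] [FiniteDimensional ℝ V]
    (g : V →ₗ[ℝ] V →ₗ[ℝ] ℝ)
    (hg_nondeg : ∀ x, (∀ y, g x y = 0) → x = 0)
    (A B : Module.End ℝ V) (h : ∀ x y, g (A x) y = g x (B y)) :
    LinearMap.trace ℝ V A = LinearMap.trace ℝ V B := by
  have hinj : Function.Injective g := by
    rw [injective_iff_map_eq_zero]
    intro x hx
    exact hg_nondeg x (fun y => by rw [hx]; rfl)
  let e : V ≃ₗ[ℝ] Module.Dual ℝ V :=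
    LinearEquiv.ofInjectiveOfFinrankEq g hinj (Subspace.dual_finrank_eq).symm
  have he : ∀ x, e x = g x := fun x => rfl
  have h1 : e.conj A = Module.Dual.transpose (R := ℝ) B := by
    ext f y
    obtain ⟨x, rfl⟩ := e.surjective f
    rw [LinearEquiv.conj_apply_apply, e.symm_apply_apply, he, he, h]
    rfl
  rw [← LinearMap.trace_conj' A e, h1, LinearMap.trace_transpose']


/-- For an algebraic curvature tensor `R` on `(V, g)` and a
`g`-skew-adjoint endomorphism `U` commuting with every curvature operator,
`ric (a, U b) = - ric (U a, b)` and `ric (a, U b) = ½ tr (U ∘ R a b)`.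
Here `ric a b = tr (x ↦ R a x b)`. -/
theorem ricci_skewAdjoint_identities
    (V : Type*) [AddCommGroup V] [Module ℝ V] [FiniteDimensional ℝ V]
    (g : V →ₗ[ℝ] V →ₗ[ℝ] ℝ)
    (hg_symm : ∀ x y, g x y = g y x)
    (hg_nondeg : ∀ x, (∀ y, g x y = 0) → x = 0)
    (R : V →ₗ[ℝ] V →ₗ[ℝ] Module.End ℝ V)
    (hR_anti : ∀ x y, R x y = - R y x)
    (hR_skew : ∀ x y u v, g (R x y u) v = - g u (R x y v))
    (hR_bianchi : ∀ x y z, R x y z + R y z x + R z x y = 0)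
    (U : Module.End ℝ V)
    (hU_skewadj : ∀ x y, g (U x) y = - g x (U y))
    (hU_comm : ∀ x y, U * R x y = R x y * U) :
    ∀ a b : V,
      LinearMap.trace ℝ V ((R a).flip (U b)) = - LinearMap.trace ℝ V ((R (U a)).flip b) ∧
      LinearMap.trace ℝ V ((R a).flip (U b)) = (1 / 2 : ℝ) * LinearMap.trace ℝ V (U * R a b) := by
  intro a b
  have ext' : ∀ x y : V, (∀ z, g x z = g y z) → x = y := by
    intro x y h
    refine sub_eq_zero.mp (hg_nondeg _ fun z => ?_)
    rw [map_sub, LinearMap.sub_apply, h, sub_self]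
  have anti : ∀ x y z w, g (R x y z) w = - g (R y x z) w := by
    intro x y z w
    rw [hR_anti x y]; simp
  have skew : ∀ x y z w, g (R x y z) w = - g (R x y w) z := by
    intro x y z w
    rw [hR_skew, hg_symm]
  have bia : ∀ x y z w, g (R x y z) w + g (R y z x) w + g (R z x y) w = 0 := by
    intro x y z w
    rw [← LinearMap.add_apply, ← map_add, ← LinearMap.add_apply, ← map_add, hR_bianchi]; simp
  have pair : ∀ x y z w, g (R x y z) w = g (R z w x) y := by
    intro x y z w
    linarith [bia x y z w, bia y z w x, bia z w x y, bia w x y z,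
      skew x y z w, skew y z x w, skew z x y w, skew y z w x, skew z w y x, skew w y z x,
      skew z w x y, skew w x z y, skew x z w y, skew w x y z, skew x y w z, skew y w x z,
      anti x y z w, anti y z x w, anti z x y w, anti y z w x, anti z w y x, anti w y z x,
      anti z w x y, anti w x z y, anti x z w y, anti w x y z, anti x y w z, anti y w x z]
  have comm : ∀ x y z, U (R x y z) = R x y (U z) := fun x y z =>
    LinearMap.congr_fun (hU_comm x y) z
  have move : ∀ x y z, R (U x) y z = - R x (U y) z := by
    intro x y z
    apply ext'
    intro w
    rw [pair, ← comm, hU_skewadj, map_neg, LinearMap.neg_apply, pair x (U y)]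
  have first : ∀ a b, LinearMap.trace ℝ V ((R a).flip (U b))
      = - LinearMap.trace ℝ V ((R (U a)).flip b) := by
    intro a b
    have h1 : (R a).flip (U b) = U * (R a).flip b := by
      ext x
      exact (comm a x b).symm
    have h2 : (R (U a)).flip b = - ((R a).flip b * U) := by
      ext x
      exact move a x b
    rw [h1, h2, LinearMap.trace_mul_comm, map_neg, neg_neg]
  have ricsymm : ∀ a b, LinearMap.trace ℝ V ((R a).flip b) = LinearMap.trace ℝ V ((R b).flip a) := by
    intro a b
    apply trace_eq_of_adj V g hg_nondeg
    intro x y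
    rw [hg_symm x]
    simp only [LinearMap.flip_apply]
    exact pair a x b y
  have h3 : U * R a b = (R a).flip (U b) - (R b).flip (U a) := by
    ext x
    change U (R a b x) = R a x (U b) - R b x (U a)
    have h := congrArg U (hR_bianchi a b x)
    rw [hR_anti x a] at h
    simp only [map_add, map_zero, LinearMap.neg_apply, map_neg] at h
    rw [← comm, ← comm, ← sub_eq_zero, ← h]
    abel
  refine ⟨first a b, ?_⟩
  rw [h3, map_sub, ricsymm b (U a)]
  linarith [first a b]
end

section
/- Let R be an algebraic curvature tensor on (V,g) and let N be a g-skew-adjoint nilpotent endomorphism of V commuting with every curvature operator R(x,y). Then ric(a,Nb) = 0 for all a, b in V; that is, the image of N is contained in the kernel of the Ricci form, so if N ≠ 0 the Ricci form is degenerate. -/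
/-- For an algebraic curvature tensor `R` on `(V, g)` and a
`g`-skew-adjoint nilpotent endomorphism `N` commuting with every curvature operator,
`ric (a, N b) = 0` for all `a, b` (so the image of `N` lies in the kernel of the Ricci
form, which is therefore degenerate when `N ≠ 0`).  Here `ric a b = tr (x ↦ R a x b)`. -/
theorem ricci_degenerate_of_skewAdjoint_nilpotent
    (V : Type*) [AddCommGroup V] [Module ℝ V] [FiniteDimensional ℝ V]
    (g : V →ₗ[ℝ] V →ₗ[ℝ] ℝ)
    (hg_symm : ∀ x y, g x y = g y x)
    (hg_nondeg : ∀ x, (∀ y, g x y = 0) → x = 0)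
    (R : V →ₗ[ℝ] V →ₗ[ℝ] Module.End ℝ V)
    (hR_anti : ∀ x y, R x y = - R y x)
    (hR_skew : ∀ x y u v, g (R x y u) v = - g u (R x y v))
    (hR_bianchi : ∀ x y z, R x y z + R y z x + R z x y = 0)
    (N : Module.End ℝ V)
    (hN_skewadj : ∀ x y, g (N x) y = - g x (N y))
    (hN_nilpotent : IsNilpotent N)
    (hN_comm : ∀ x y, N * R x y = R x y * N) :
    (∀ a b : V, LinearMap.trace ℝ V ((R a).flip (N b)) = 0) ∧
    (N ≠ 0 → ∃ v : V, v ≠ 0 ∧ ∀ a : V, LinearMap.trace ℝ V ((R a).flip v) = 0) := by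
  -- pair symmetry
  have anti : ∀ x y z w, g (R x y z) w = - g (R y x z) w := by
    intro x y z w
    rw [hR_anti x y]; simp
  have skew : ∀ x y z w, g (R x y z) w = - g (R x y w) z := by
    intro x y z w
    rw [hR_skew, hg_symm]
  have bia : ∀ x y z w, g (R x y z) w + g (R y z x) w + g (R z x y) w = 0 := by
    intro x y z w
    have h := congrArg (fun t => g t w) (hR_bianchi x y z)
    simpa using h
  have pair : ∀ x y z w, g (R x y z) w = g (R z w x) y := by
    intro x y z w
    linarith [bia x y z w, bia y z w x, bia z w x y, bia w x y z,
      skew x y z w, skew y z x w, skew z x y w, skew z w y x, skew w y z x,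
      skew w x z y, skew x z w y, skew x y w z, skew y w x z, skew z w x y,
      skew y z w x, skew w x y z,
      anti x z y w, anti y w x z, anti x z w y, anti y w z x]
  have shift : ∀ x y, R (N x) y = - R x (N y) := by
    intro x y
    ext z
    rw [← sub_eq_zero]
    apply hg_nondeg
    intro w
    have h1 := pair (N x) y z w
    have h2 : R z w (N x) = N (R z w x) := (LinearMap.congr_fun (hN_comm z w) x).symm
    rw [h2, hN_skewadj, ← pair x (N y) z w] at h1
    simp [h1]
  -- skew operators are traceless
  have hker : LinearMap.ker g = ⊥ := by
    rw [LinearMap.ker_eq_bot']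
    intro x hx
    exact hg_nondeg x fun y => by rw [hx]; rfl
  have tr0 : ∀ x y, LinearMap.trace ℝ V (R x y) = 0 := by
    intro x y
    let e : V ≃ₗ[ℝ] Module.Dual ℝ V :=
      LinearEquiv.ofInjectiveOfFinrankEq g (LinearMap.ker_eq_bot.mp hker)
        (Subspace.dual_finrank_eq).symm
    have he : ∀ v, e v = g v := fun v => rfl
    have h : e.conj (- R x y) = Module.Dual.transpose (R := ℝ) (R x y) := by
      refine LinearMap.ext fun f => LinearMap.ext fun v => ?_
      obtain ⟨u, rfl⟩ := e.surjective f
      rw [LinearEquiv.conj_apply_apply, LinearEquiv.symm_apply_apply, Module.Dual.transpose_apply,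
        he, he]
      simp [hR_skew]
    have h1 := LinearMap.trace_conj' (- R x y) e
    rw [h, map_neg] at h1
    have h2 := LinearMap.trace_transpose' (R x y)
    have h3 := h2.symm.trans h1
    linarith
  have ric_symm : ∀ a b, LinearMap.trace ℝ V ((R a).flip b) = LinearMap.trace ℝ V ((R b).flip a) := by
    intro a b
    have h : R a b = (R a).flip b - (R b).flip a := by
      ext x
      have h1 := hR_bianchi a b x
      rw [hR_anti x a] at h1
      simp only [LinearMap.sub_apply, LinearMap.flip_apply, LinearMap.neg_apply] at h1 ⊢
      rw [← sub_eq_zero, ← h1]; abel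
    have h2 := tr0 a b
    rw [h, map_sub] at h2
    linarith
  have flipN : ∀ a b, (R a).flip (N b) = N * (R a).flip b := by
    intro a b
    ext x
    exact (LinearMap.congr_fun (hN_comm a x) b).symm
  have ric_skew : ∀ a b, LinearMap.trace ℝ V ((R a).flip (N b))
      = - LinearMap.trace ℝ V ((R (N a)).flip b) := by
    intro a b
    rw [flipN, LinearMap.trace_mul_comm, ← map_neg]
    congr 1
    ext x
    simp [shift]
  have trN : ∀ a b, LinearMap.trace ℝ V (N * R a b) = 0 := by
    intro a b
    have hc : Commute N (R a b) := hN_comm a b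
    exact (LinearMap.isNilpotent_trace_of_isNilpotent (hc.isNilpotent_mul_right hN_nilpotent)).eq_zero
  have main : ∀ a b : V, LinearMap.trace ℝ V ((R a).flip (N b)) = 0 := by
    intro a b
    have h : N * R a b = (R a).flip (N b) - (R b).flip (N a) := by
      rw [flipN, flipN, ← mul_sub]
      congr 1
      ext x
      have h1 := hR_bianchi a b x
      rw [hR_anti x a] at h1
      simp only [LinearMap.sub_apply, LinearMap.flip_apply, LinearMap.neg_apply] at h1 ⊢
      rw [← sub_eq_zero, ← h1]; abel
    have h2 := trN a b
    rw [h, map_sub] at h2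
    have h3 := ric_skew a b
    rw [ric_symm (N a) b] at h3
    linarith
  refine ⟨main, fun hN => ?_⟩
  obtain ⟨b, hb⟩ : ∃ b, N b ≠ 0 := by
    by_contra hcon
    push Not at hcon
    exact hN (LinearMap.ext hcon)
  exact ⟨N b, hb, fun a => main a b⟩
end

section
/- Let R be an algebraic curvature tensor on (V,g) and let U and W be g-skew-adjoint endomorphisms of V, each commuting with every curvature operator R(x,y). Then ric(a,(U∘W - W∘U)b) = 0 for all a, b in V; that is, the image of the commutator U∘W - W∘U is contained in the kernel of the Ricci form. -/
theorem aux_trace_skew (V : Type*) [AddCommGroup V] [Module ℝ V] [FiniteDimensional ℝ V]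
    (g : V →ₗ[ℝ] V →ₗ[ℝ] ℝ)
    (hg_nondeg : ∀ x, (∀ y, g x y = 0) → x = 0)
    (A : Module.End ℝ V) (hA : ∀ x y, g (A x) y = - g x (A y)) :
    LinearMap.trace ℝ V A = 0 := by
  have hinj : Function.Injective g := by
    rw [injective_iff_map_eq_zero]
    intro x hx
    exact hg_nondeg x (fun y => by rw [hx]; rfl)
  let e : V ≃ₗ[ℝ] Module.Dual ℝ V :=
    LinearEquiv.ofInjectiveOfFinrankEq g hinj (Subspace.dual_finrank_eq (K := ℝ) (V := V)).symm
  have he : ∀ x y, e x y = g x y := fun x y => rfl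
  let B : Module.End ℝ (Module.Dual ℝ V) := Module.Dual.transpose (R := ℝ) A
  have h1 : e.conj A = (-1 : ℝ) • B := by
    ext f y
    obtain ⟨x, rfl⟩ := e.surjective f
    simp [B, LinearEquiv.conj_apply, he, hA, Module.Dual.transpose_apply]
  have h2 := LinearMap.trace_conj' A e
  have h3 : LinearMap.trace ℝ _ B = LinearMap.trace ℝ V A := LinearMap.trace_transpose' (R := ℝ) A
  rw [h1, map_smul, h3, smul_eq_mul] at h2
  linarith

/-- For an algebraic curvature tensor `R` on `(V, g)` and
`g`-skew-adjoint endomorphisms `U`, `W` commuting with every curvature operator,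
`ric (a, (U∘W - W∘U) b) = 0` for all `a, b`: the image of the commutator `U∘W - W∘U`
lies in the kernel of the Ricci form.  Here `ric a b = tr (x ↦ R a x b)`. -/
theorem ricci_annihilates_commutator_of_skewAdjoint
    (V : Type*) [AddCommGroup V] [Module ℝ V] [FiniteDimensional ℝ V]
    (g : V →ₗ[ℝ] V →ₗ[ℝ] ℝ)
    (hg_symm : ∀ x y, g x y = g y x)
    (hg_nondeg : ∀ x, (∀ y, g x y = 0) → x = 0)
    (R : V →ₗ[ℝ] V →ₗ[ℝ] Module.End ℝ V)
    (hR_anti : ∀ x y, R x y = - R y x)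
    (hR_skew : ∀ x y u v, g (R x y u) v = - g u (R x y v))
    (hR_bianchi : ∀ x y z, R x y z + R y z x + R z x y = 0)
    (U W : Module.End ℝ V)
    (hU_skewadj : ∀ x y, g (U x) y = - g x (U y))
    (hW_skewadj : ∀ x y, g (W x) y = - g x (W y))
    (hU_comm : ∀ x y, U * R x y = R x y * U)
    (hW_comm : ∀ x y, W * R x y = R x y * W) :
    ∀ a b : V, LinearMap.trace ℝ V ((R a).flip ((U * W - W * U) b)) = 0 := by
  have sub0 : ∀ x y, (∀ v, g x v = g y v) → x = y := by
    intro x y h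
    have := hg_nondeg (x - y) (fun v => by simp [h v])
    exact sub_eq_zero.mp this
  have anti : ∀ x y u v, g (R x y u) v = - g (R y x u) v := by
    intro x y u v
    rw [hR_anti x y]; simp
  have skew : ∀ x y u v, g (R x y u) v = - g (R x y v) u := by
    intro x y u v
    rw [hR_skew, hg_symm]
  have bia : ∀ x y z v, g (R x y z) v + g (R y z x) v + g (R z x y) v = 0 := by
    intro x y z v
    have := congrArg (fun t => g t v) (hR_bianchi x y z)
    simpa using this
  have pair : ∀ x y u v, g (R x y u) v = g (R u v x) y := by
    intro x y u v
    linarith [bia x y u v, bia y u v x, bia u v x y, bia v x y u,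
      anti x y u v, anti y u x v, anti u x y v, anti u v y x, anti y u v x, anti v y u x,
      anti v x u y, anti x u v y, anti x y v u, anti v x y u, anti y v x u,
      anti x v y u, anti x v u y,
      skew x y u v, skew y u x v, skew u x y v, skew v y u x, skew u v x y, skew v x u y,
      skew x v y u, skew x u v y, skew y v x u]
  have move : ∀ T : Module.End ℝ V, (∀ x y, g (T x) y = - g x (T y)) →
      (∀ x y, T * R x y = R x y * T) → ∀ x y, R (T x) y = - R x (T y) := by
    intro T hT hc x y
    ext u
    apply sub0
    intro v
    have h : R u v (T x) = T (R u v x) := (LinearMap.congr_fun (hc u v) x).symm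
    rw [pair, h, hT, LinearMap.neg_apply, map_neg, LinearMap.neg_apply, pair x (T y) u v]
  have trR : ∀ x y, LinearMap.trace ℝ V (R x y) = 0 := fun x y =>
    aux_trace_skew V g hg_nondeg _ (hR_skew x y)
  have flipB : ∀ a b, (R a).flip b = (R b).flip a + R a b := by
    intro a b
    ext x
    have h1 := hR_bianchi a x b
    have h2 : R x b a = - R b x a := by rw [hR_anti]; rfl
    have h3 : R b a x = - R a b x := by rw [hR_anti]; rfl
    rw [h2, h3] at h1
    simp only [LinearMap.flip_apply, LinearMap.add_apply]
    rw [← sub_eq_zero, ← h1]; abel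
  have ricsymm : ∀ a b, LinearMap.trace ℝ V ((R a).flip b) = LinearMap.trace ℝ V ((R b).flip a) := by
    intro a b
    rw [flipB, map_add, trR, add_zero]
  have flipT : ∀ T : Module.End ℝ V, (∀ x y, T * R x y = R x y * T) →
      ∀ a b, (R a).flip (T b) = T * (R a).flip b := by
    intro T hc a b
    ext x
    exact (LinearMap.congr_fun (hc a x) b).symm
  have ricskew : ∀ T : Module.End ℝ V, (∀ x y, g (T x) y = - g x (T y)) →
      (∀ x y, T * R x y = R x y * T) → ∀ a b,
      LinearMap.trace ℝ V ((R a).flip (T b)) = - LinearMap.trace ℝ V ((R (T a)).flip b) := by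
    intro T hT hc a b
    rw [flipT T hc, LinearMap.trace_mul_comm, ← map_neg]
    congr 1
    ext x
    simp [move T hT hc a x]
  have key : ∀ T : Module.End ℝ V, (∀ x y, g (T x) y = - g x (T y)) →
      (∀ x y, T * R x y = R x y * T) → ∀ a b,
      2 * LinearMap.trace ℝ V ((R a).flip (T b)) = LinearMap.trace ℝ V (T * R a b) := by
    intro T hT hc a b
    have h1 : LinearMap.trace ℝ V ((R a).flip (T b)) =
        LinearMap.trace ℝ V ((R b).flip (T a)) + LinearMap.trace ℝ V (T * R a b) := by
      rw [flipT T hc, flipT T hc, flipB a b, mul_add, map_add]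
    have h2 := ricskew T hT hc a b
    have h3 := ricsymm b (T a)
    linarith
  intro a b
  have e1 := key U hU_skewadj hU_comm a (W b)
  have e2 := key U hU_skewadj hU_comm (W a) b
  have e3 := ricskew W hW_skewadj hW_comm a (U b)
  rw [move W hW_skewadj hW_comm a b, mul_neg, map_neg] at e2
  have e4 : (U * W - W * U) b = U (W b) - W (U b) := rfl
  rw [e4, map_sub, map_sub]
  linarith
end

section
/- Let R be an algebraic curvature tensor on (V,g) and let U and W be g-skew-adjoint endomorphisms of V, each commuting with every curvature operator R(x,y). If U and W are invertible and anticommute (U∘W = -W∘U), then the Ricci form vanishes identically: ric(a,b) = 0 for all a, b in V. (This is the algebraic content of the Ricci-flatness of pseudo-hyperkahler, para-hyperkahler and complex hyperkahler metrics.) -/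
/-- For an algebraic curvature tensor `R` on `(V, g)` and
`g`-skew-adjoint endomorphisms `U`, `W` commuting with every curvature operator:
if `U` and `W` are invertible and anticommute, then the Ricci form vanishes identically.
Here `ric a b = tr (x ↦ R a x b)`. -/
theorem ricci_flat_of_anticommuting_skewAdjoint
    (V : Type*) [AddCommGroup V] [Module ℝ V] [FiniteDimensional ℝ V]
    (g : V →ₗ[ℝ] V →ₗ[ℝ] ℝ)
    (hg_symm : ∀ x y, g x y = g y x)
    (hg_nondeg : ∀ x, (∀ y, g x y = 0) → x = 0)
    (R : V →ₗ[ℝ] V →ₗ[ℝ] Module.End ℝ V)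
    (hR_anti : ∀ x y, R x y = - R y x)
    (hR_skew : ∀ x y u v, g (R x y u) v = - g u (R x y v))
    (hR_bianchi : ∀ x y z, R x y z + R y z x + R z x y = 0)
    (U W : Module.End ℝ V)
    (hU_skewadj : ∀ x y, g (U x) y = - g x (U y))
    (hW_skewadj : ∀ x y, g (W x) y = - g x (W y))
    (hU_comm : ∀ x y, U * R x y = R x y * U)
    (hW_comm : ∀ x y, W * R x y = R x y * W)
    (hU_inv : IsUnit U) (hW_inv : IsUnit W)
    (h_anticomm : U * W = -(W * U)) :
    ∀ a b : V, LinearMap.trace ℝ V ((R a).flip b) = 0 := by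
  have hsk : ∀ x y u v, g (R x y u) v = - g (R x y v) u := fun x y u v => by
    rw [hR_skew, hg_symm]
  have han : ∀ x y u v, g (R x y u) v = - g (R y x u) v := fun x y u v => by
    rw [hR_anti]; simp
  have hbi : ∀ x y z v, g (R x y z) v + g (R y z x) v + g (R z x y) v = 0 := fun x y z v => by
    have h := congrArg (fun t => g t v) (hR_bianchi x y z)
    simpa using h
  have hpair : ∀ x y u v, g (R x y u) v = g (R u v x) y := fun x y u v => by
    linarith [hbi x y u v, hbi y u v x, hbi u v x y, hbi v x y u,
      hsk x y u v, hsk y u v x, hsk u v x y, hsk v x y u, hsk y u x v, hsk u x y v,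
      hsk u v y x, hsk v y u x, hsk v x u y, hsk x u v y, hsk x y v u, hsk y v x u,
      han x y u v, han y u v x, han u v x y, han v x y u, han y u x v, han u x y v,
      han u v y x, han v y u x, han v x u y, han x u v y, han x y v u, han y v x u]
  have hUc : ∀ x y z, U (R x y z) = R x y (U z) := fun x y z =>
    LinearMap.congr_fun (hU_comm x y) z
  have hinj : ∀ p q : V, (∀ v, g p v = g q v) → p = q := fun p q h => by
    rw [← sub_eq_zero]
    apply hg_nondeg
    intro y
    simp [h y]
  have hUR : ∀ x y u, R (U x) y u = - R x (U y) u := fun x y u => by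
    apply hinj
    intro v
    rw [hpair, ← hUc, hU_skewadj, ← hpair]
    simp
  have htr0 : ∀ x y, LinearMap.trace ℝ V (R x y) = 0 := fun x y => by
    have hgi : Function.Injective g := by
      rw [← LinearMap.ker_eq_bot, LinearMap.ker_eq_bot']
      intro m hm
      exact hg_nondeg m (fun y => by rw [hm]; rfl)
    let G : V ≃ₗ[ℝ] Module.Dual ℝ V :=
      LinearMap.linearEquivOfInjective g hgi (Subspace.dual_finrank_eq).symm
    have h1 : G.conj (R x y) = - Module.Dual.transpose (R := ℝ) (R x y) := by
      ext f v
      obtain ⟨u, rfl⟩ := G.surjective f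
      simp only [LinearEquiv.conj_apply_apply, LinearEquiv.symm_apply_apply]
      exact hR_skew x y u v
    have h2 := LinearMap.trace_conj' (R x y) G
    rw [h1] at h2
    have h3 := (map_neg (LinearMap.trace ℝ (Module.Dual ℝ V))
      (Module.Dual.transpose (R := ℝ) (R x y))).symm.trans h2
    rw [LinearMap.trace_transpose'] at h3
    linarith
  have hUR0 : ∀ a b, LinearMap.trace ℝ V (U * R a b) = 0 := fun a b => by
    obtain ⟨w, rfl⟩ := hW_inv
    have h1 : U * R a b = - ((w : Module.End ℝ V) * (U * R a b) * (↑w⁻¹ : Module.End ℝ V)) := by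
      have : (w : Module.End ℝ V) * (U * R a b) = - (U * R a b * w) := by
        rw [mul_assoc U, ← hW_comm, ← mul_assoc, ← mul_assoc, h_anticomm, neg_mul, neg_neg]
      rw [this]
      simp [mul_assoc]
    have h2 : LinearMap.trace ℝ V ((w : Module.End ℝ V) * (U * R a b) * (↑w⁻¹ : Module.End ℝ V))
        = LinearMap.trace ℝ V (U * R a b) := by
      rw [LinearMap.trace_mul_comm, ← mul_assoc]
      simp
    have h3 := congrArg (LinearMap.trace ℝ V) h1
    rw [map_neg, h2] at h3
    linarith
  have hA : ∀ a b, U * R a b = (R a).flip (U b) - (R b).flip (U a) := fun a b => by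
    ext x
    have h := hR_bianchi a b x
    have h' : R a b x = R a x b - R b x a := by
      rw [hR_anti x a] at h
      simp only [LinearMap.neg_apply] at h
      rw [← sub_eq_zero, ← h]; abel
    simp [h', hUc]
  have hB : ∀ a b, (R a).flip (U b) = R a (U b) - (R b).flip a * U := fun a b => by
    ext x
    have h := hR_bianchi a x (U b)
    have e : R x (U b) a = R b (U x) a := by
      rw [← neg_eq_iff_eq_neg.mpr (hUR x b a), hR_anti b]; simp
    rw [e, hR_anti (U b) a] at h
    simp only [LinearMap.neg_apply] at h
    simp only [LinearMap.flip_apply, LinearMap.sub_apply, Module.End.mul_apply]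
    rw [← sub_eq_zero, ← h]; abel
  have hC : ∀ a b, U * (R b).flip a = (R b).flip (U a) := fun a b => by
    ext x
    simp [hUc]
  intro a b
  obtain ⟨c, rfl⟩ : ∃ c, U c = b := ((Module.End.isUnit_iff U).mp hU_inv).surjective b
  have h1 := congrArg (LinearMap.trace ℝ V) (hA a c)
  have h2 := congrArg (LinearMap.trace ℝ V) (hB a c)
  rw [hUR0, map_sub] at h1
  rw [map_sub, htr0, LinearMap.trace_mul_comm, hC] at h2
  linarith
end

section
/- Let R be an algebraic curvature tensor on (V,g) and let S be a set of endomorphisms of V containing every curvature operator R(x,y), whose action on V is orthogonally indecomposable. Let Ric be the unique endomorphism of V satisfying g(a, Ric b) = ric(a,b) for all a, b, and assume that Ric commutes with every element of S (this models a metric with parallel Ricci tensor). Then either Ric is a semisimple endomorphism or Ric∘Ric = 0. -/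
set_option maxHeartbeats 2000000

/-- Let `R` be an algebraic curvature tensor on `(V, g)` and `S` a set
of endomorphisms containing every curvature operator, whose action is orthogonally
indecomposable.  If `Ric` (defined by `g (a, Ric b) = ric (a, b)`) commutes with every
element of `S` (parallel Ricci tensor), then `Ric` is semisimple or `Ric ∘ Ric = 0`. -/
theorem ricci_endomorphism_semisimple_or_two_step_nilpotent
    (V : Type*) [AddCommGroup V] [Module ℝ V] [FiniteDimensional ℝ V]
    (g : V →ₗ[ℝ] V →ₗ[ℝ] ℝ)
    (hg_symm : ∀ x y, g x y = g y x)
    (hg_nondeg : ∀ x, (∀ y, g x y = 0) → x = 0)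
    (R : V →ₗ[ℝ] V →ₗ[ℝ] Module.End ℝ V)
    (hR_anti : ∀ x y, R x y = - R y x)
    (hR_skew : ∀ x y u v, g (R x y u) v = - g u (R x y v))
    (hR_bianchi : ∀ x y z, R x y z + R y z x + R z x y = 0)
    (S : Set (Module.End ℝ V))
    (hS_curv : ∀ x y : V, R x y ∈ S)
    (hS_indec : ¬ ∃ W₁ W₂ : Submodule ℝ V, W₁ ≠ ⊥ ∧ W₂ ≠ ⊥ ∧ IsCompl W₁ W₂ ∧
      (∀ u ∈ W₁, ∀ v ∈ W₂, g u v = 0) ∧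
      (∀ T ∈ S, ∀ w ∈ W₁, T w ∈ W₁) ∧ (∀ T ∈ S, ∀ w ∈ W₂, T w ∈ W₂))
    (Ric : Module.End ℝ V)
    (hRic : ∀ a b : V, g a (Ric b) = LinearMap.trace ℝ V ((R a).flip b))
    (hRic_comm : ∀ T ∈ S, Ric * T = T * Ric) :
    Ric.IsSemisimple ∨ Ric * Ric = 0 := by
  have hpair : ∀ x y z w, g (R x y z) w = g (R z w x) y := by
    intro x y z w
    have b : ∀ x y z w, g (R x y z) w + g (R y z x) w + g (R z x y) w = 0 := by
      intro x y z w
      have := congrArg (fun v => g v w) (hR_bianchi x y z)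
      simpa using this
    have an : ∀ x y z w, g (R x y z) w = - g (R y x z) w := by
      intro x y z w
      rw [hR_anti x y]; simp
    have sk : ∀ x y z w, g (R x y z) w = - g (R x y w) z := by
      intro x y z w
      rw [hR_skew, hg_symm]
    linarith [b x y z w, b y z w x, b z w x y, b w x y z, an x y z w, an y z x w, an z x y w,
      an y z w x, an z w y x, an w y z x, an z w x y, an w x z y, an x z w y,
      an w x y z, an x y w z, an y w x z,
      sk x y z w, sk y z x w, sk z x y w, sk y z w x, sk z w y x, sk w y z x, sk z w x y,
      sk w x z y, sk x z w y, sk w x y z, sk x y w z, sk y w x z]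
  have hext : ∀ u v : V, (∀ w, g u w = g v w) → u = v := by
    intro u v h
    rw [← sub_eq_zero]
    apply hg_nondeg
    intro w
    simp [h w]
  have hinj : Function.Injective g := by
    intro u v h
    exact hext u v (fun w => by rw [h])
  have htr : ∀ a b, LinearMap.trace ℝ V ((R a).flip b) = LinearMap.trace ℝ V ((R b).flip a) := by
    intro a b
    let e : V ≃ₗ[ℝ] Module.Dual ℝ V := LinearEquiv.ofInjectiveOfFinrankEq g hinj
      (Subspace.dual_finrank_eq).symm
    have he : ∀ x, e x = g x := fun x => rfl
    have h1 : Module.Dual.transpose (R := ℝ) ((R b).flip a) = e.conj ((R a).flip b) := by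
      ext f w
      obtain ⟨x, rfl⟩ := e.surjective f
      simp only [LinearEquiv.conj_apply_apply, he,
        Module.Dual.transpose_apply, LinearMap.comp_apply, LinearMap.flip_apply]
      have h2 : e.symm (e x) = x := e.symm_apply_apply x
      rw [← he x, h2, he, hg_symm, hpair, hg_symm]
    rw [← LinearMap.trace_transpose' ((R b).flip a), h1, LinearMap.trace_conj']
  have hself : ∀ x y, g (Ric x) y = g x (Ric y) := by
    intro x y
    rw [hg_symm, hRic, hRic, htr]
  -- elements of the algebra
  have hA : ∀ U ∈ Algebra.adjoin ℝ {Ric}, (∀ x y, g (U x) y = g x (U y)) ∧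
      (∀ T ∈ S, ∀ v, U (T v) = T (U v)) := by
    intro U hU
    have hc : ∀ U ∈ Algebra.adjoin ℝ {Ric}, Commute U Ric := by
      intro U hU
      exact (Algebra.commute_of_mem_adjoin_self hU).symm
    induction hU using Algebra.adjoin_induction with
    | mem x hx =>
      rw [Set.mem_singleton_iff] at hx
      subst hx
      exact ⟨hself, fun T hT v => LinearMap.congr_fun (hRic_comm T hT) v⟩
    | algebraMap r => simp [Module.algebraMap_end_apply]
    | add x y hx hy h1 h2 =>
      refine ⟨fun a b => by simp [h1.1, h2.1], fun T hT v => by simp [h1.2 T hT, h2.2 T hT]⟩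
    | mul x y hx hy h1 h2 =>
      have hxy : x * y = y * x :=
        (Algebra.commute_of_mem_adjoin_of_forall_mem_commute hy (fun b hb => by
          rw [Set.mem_singleton_iff] at hb
          rw [hb]
          exact hc x hx)).eq
      refine ⟨fun a b => ?_, fun T hT v => by simp [h1.2 T hT, h2.2 T hT]⟩
      have := LinearMap.congr_fun hxy b
      rw [this]
      simp [h1.1, h2.1]
  have hkey : ∀ N ∈ Algebra.adjoin ℝ {Ric}, IsNilpotent N → ∀ v, N (Ric v) = 0 := by
    intro N hN hnil v
    obtain ⟨hs, hcm⟩ := hA N hN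
    have hmv : ∀ x y z, R (N x) y z = R x (N y) z := by
      intro x y z
      apply hext
      intro w
      rw [hpair, hpair x, ← hcm _ (hS_curv z w), hs]
    have hQ : ∀ x y z, R (N x) y z = N (R x y z) := by
      intro x y z
      have b : ∀ x y z, R (N x) y z + N (R y z x) + R (N z) x y = 0 := by
        intro x y z
        have := hR_bianchi (N x) y z
        rwa [← hmv z x, ← hcm _ (hS_curv y z)] at this
      have c : N (R x y z) + N (R y z x) + N (R z x y) = 0 := by
        rw [← map_add, ← map_add, hR_bianchi, map_zero]
      have b1 := b x y z
      have b2 := b y z x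
      have b3 := b z x y
      have h2 : (2:ℝ) • (R (N x) y z - N (R x y z)) = 0 := by
        calc (2:ℝ) • (R (N x) y z - N (R x y z))
            = (R (N x) y z + N (R y z x) + R (N z) x y) + (R (N y) z x + N (R z x y) + R (N x) y z)
              - (R (N z) x y + N (R x y z) + R (N y) z x)
              - (N (R x y z) + N (R y z x) + N (R z x y)) := by module
          _ = 0 := by rw [b1, b2, b3, c]; simp
      have := (smul_eq_zero.mp h2).resolve_left two_ne_zero
      exact sub_eq_zero.mp this
    apply hg_nondeg
    intro a
    rw [hs, hg_symm, hRic]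
    have h1 : (R (N a)).flip v = N * (R a).flip v := by
      ext x; simp [hQ]
    have h2 : Commute N ((R a).flip v) := by
      ext x; simp [← hQ, hmv]
    rw [h1]
    exact (LinearMap.isNilpotent_trace_of_isNilpotent (h2.isNilpotent_mul_right hnil)).eq_zero
  obtain ⟨N, hN, s, hsm, hnil, hss, hdec⟩ := Module.End.exists_isNilpotent_isSemisimple (f := Ric)
  obtain ⟨n, hn, hn1⟩ := ((LinearMap.eventually_isCompl_ker_pow_range_pow Ric).and
    (Filter.eventually_ge_atTop 1)).exists
  obtain ⟨hs, hcm⟩ := hA (Ric ^ n) (pow_mem (Algebra.self_mem_adjoin_singleton ℝ Ric) n)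
  have hor : LinearMap.ker (Ric ^ n) = ⊥ ∨ LinearMap.range (Ric ^ n) = ⊥ := by
    by_contra! hcon
    refine hS_indec ⟨_, _, hcon.1, hcon.2, hn, ?_, ?_, ?_⟩
    · rintro u hu _ ⟨w, rfl⟩
      rw [← hs, LinearMap.mem_ker.mp hu]; simp
    · intro T hT w hw
      rw [LinearMap.mem_ker] at hw ⊢
      rw [hcm T hT, hw, map_zero]
    · rintro T hT _ ⟨w, rfl⟩
      exact ⟨T w, hcm T hT w⟩
  rcases hor with h | h
  · left
    have hN0 : N = 0 := by
      have hsurj : Function.Surjective (Ric ^ n) :=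
        LinearMap.injective_iff_surjective.mp (LinearMap.ker_eq_bot.mp h)
      ext v
      obtain ⟨w, rfl⟩ := hsurj v
      obtain ⟨k, rfl⟩ := Nat.exists_eq_succ_of_ne_zero (Nat.one_le_iff_ne_zero.mp hn1)
      rw [pow_succ']
      exact hkey N hN hnil _
    rw [hdec, hN0, zero_add]; exact hss
  · right
    have : IsNilpotent Ric := ⟨n, LinearMap.range_eq_bot.mp h⟩
    ext v
    exact hkey Ric (Algebra.self_mem_adjoin_singleton ℝ Ric) this v
end

section
/- Fix p ≥ 1 and let V = H^p x H^p, the direct sum of two copies of the space of quaternionic column p-vectors, regarded as a real vector space of dimension 8p. Define the real symmetric bilinear form g((x1,x2),(y1,y2)) = Re(x1† y2) + Re(y1† x2), where x† denotes the quaternionic conjugate transpose and Re the real part of a quaternion. Let S be the set of real-linear maps (x1,x2) -> (u·x1, (u†)⁻¹·x2), where u ranges over the invertible p x p quaternionic matrices and · is matrix-vector multiplication. Then: (a) g is nondegenerate; (b) every element of S preserves g; (c) the action of S on V is orthogonally indecomposable; and (d) the commutant of S in the algebra of real-linear endomorphisms of V is isomorphic as a real algebra to H x H. (This shows that, without the Bianchi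 identity, the algebra H ⊕ H can occur as an orthogonally indecomposable self-adjoint semisimple commutant.) -/
open scoped Quaternion

/-- The real vector space `ℍᵖ × ℍᵖ` of Remark 2.11 (`bianchi_indispensable`). -/
abbrev QuatPairSpace (p : ℕ) :=
  (Fin p → Quaternion ℝ) × (Fin p → Quaternion ℝ)

/-- The neutral symmetric bilinear form
`g((x₁,x₂),(y₁,y₂)) = Re(x₁† y₂) + Re(y₁† x₂)` on `ℍᵖ × ℍᵖ`. -/
noncomputable def quatPairForm (p : ℕ) (x y : QuatPairSpace p) : ℝ :=
  (∑ i, star (x.1 i) * y.2 i).re + (∑ i, star (y.1 i) * x.2 i).re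

/-- The set of real-linear maps `(x₁,x₂) ↦ (u·x₁, (u†)⁻¹·x₂)`, for `u` an invertible
`p × p` quaternionic matrix. -/
def quatPairGroup (p : ℕ) : Set (Module.End ℝ (QuatPairSpace p)) :=
  {T | ∃ u : Matrix (Fin p) (Fin p) (Quaternion ℝ), IsUnit u ∧
    ∀ x : QuatPairSpace p,
      T x = (u.mulVec x.1, (Ring.inverse u.conjTranspose).mulVec x.2)}

namespace QPaux

open Matrix

noncomputable def D {p : ℕ} (a b : Matrix (Fin p) (Fin p) (Quaternion ℝ)) :
    Module.End ℝ (QuatPairSpace p) where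
  toFun x := (a.mulVec x.1, b.mulVec x.2)
  map_add' x y := by simp [Matrix.mulVec_add]
  map_smul' c x := by simp [Matrix.mulVec_smul]

theorem D_apply {p : ℕ} (a b : Matrix (Fin p) (Fin p) (Quaternion ℝ)) (x : QuatPairSpace p) :
    D a b x = (a.mulVec x.1, b.mulVec x.2) := rfl

theorem D_mem {p : ℕ} (u w : Matrix (Fin p) (Fin p) (Quaternion ℝ)) (hu : IsUnit u)
    (h : u.conjTranspose * w = 1) : D u w ∈ quatPairGroup p := by
  refine ⟨u, hu, fun x => ?_⟩
  have h1 : IsUnit u.conjTranspose := by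
    rw [← Matrix.star_eq_conjTranspose]; exact hu.star
  have h2 : Ring.inverse u.conjTranspose = w := by
    calc _ = Ring.inverse u.conjTranspose * (u.conjTranspose * w) := by rw [h, mul_one]
      _ = w := by rw [← mul_assoc, Ring.inverse_mul_cancel _ h1, one_mul]
  rw [h2]; rfl

attribute [local instance] Matrix.linftyOpNormedRing Matrix.linftyOpNormedAlgebra in
theorem exists_unit {p : ℕ} (M : Matrix (Fin p) (Fin p) (Quaternion ℝ)) :
    ∃ t : ℝ, IsUnit (t • 1 + M : Matrix (Fin p) (Fin p) (Quaternion ℝ)) := by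
  have : CompleteSpace (Matrix (Fin p) (Fin p) (Quaternion ℝ)) :=
    FiniteDimensional.complete ℝ _
  let k := ‖(-M)‖ * ‖(1 : Matrix (Fin p) (Fin p) (Quaternion ℝ))‖ + 1
  refine ⟨k, ?_⟩
  by_contra h
  have hk : k ∈ spectrum ℝ (-M) := by
    rw [spectrum.mem_iff, sub_neg_eq_add, Algebra.algebraMap_eq_smul_one]; exact h
  have := spectrum.norm_le_norm_mul_of_mem hk
  have h2 : k ≤ ‖k‖ := le_abs_self k
  have : k ≤ k - 1 := by
    simp only [k] at *
    linarith
  linarith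

theorem L1_unit {p : ℕ} (u w : Matrix (Fin p) (Fin p) (Quaternion ℝ)) (hu : IsUnit u)
    (h : u.conjTranspose * w = 1) :
    D u 0 ∈ Submodule.span ℝ (quatPairGroup p) ∧ D 0 w ∈ Submodule.span ℝ (quatPairGroup p) := by
  have m1 := Submodule.subset_span (R := ℝ) (D_mem u w hu h)
  have hu2 : IsUnit ((2 : ℝ) • u) := by
    have := hu.smul (Units.mk0 (2 : ℝ) two_ne_zero)
    simpa [Units.smul_def] using this
  have m2 := Submodule.subset_span (R := ℝ) (D_mem ((2 : ℝ) • u) ((1/2 : ℝ) • w) hu2 (by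
    have hs : ((2 : ℝ) • u).conjTranspose = (2 : ℝ) • u.conjTranspose := by
      apply Matrix.ext; intro i j
      simp only [Matrix.conjTranspose_apply, Matrix.smul_apply]
      exact Quaternion.star_smul _ _
    rw [hs, smul_mul_smul_comm, h]; simp))
  constructor
  · have : D u 0 = (2/3 : ℝ) • (D ((2 : ℝ) • u) ((1/2 : ℝ) • w) - (1/2 : ℝ) • D u w) := by
      apply LinearMap.ext; intro x
      simp only [LinearMap.smul_apply, LinearMap.sub_apply, D_apply, Matrix.smul_mulVec,
        Matrix.zero_mulVec, Prod.smul_mk, Prod.mk_sub_mk, ← sub_smul, smul_smul, sub_self]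
      norm_num
    rw [this]
    exact Submodule.smul_mem _ _ (Submodule.sub_mem _ m2 (Submodule.smul_mem _ _ m1))
  · have : D 0 w = (2/3 : ℝ) • ((2 : ℝ) • D u w - D ((2 : ℝ) • u) ((1/2 : ℝ) • w)) := by
      apply LinearMap.ext; intro x
      simp only [LinearMap.smul_apply, LinearMap.sub_apply, D_apply, Matrix.smul_mulVec,
        Matrix.zero_mulVec, Prod.smul_mk, Prod.mk_sub_mk, ← sub_smul, smul_smul, sub_self]
      norm_num
    rw [this]
    exact Submodule.smul_mem _ _ (Submodule.sub_mem _ (Submodule.smul_mem _ _ m1) m2)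

theorem L1 {p : ℕ} (M : Matrix (Fin p) (Fin p) (Quaternion ℝ)) :
    D M 0 ∈ Submodule.span ℝ (quatPairGroup p) := by
  have key : ∀ u : Matrix (Fin p) (Fin p) (Quaternion ℝ), IsUnit u →
      D u 0 ∈ Submodule.span ℝ (quatPairGroup p) := by
    intro u hu
    have h1 : IsUnit u.conjTranspose := by
      rw [← Matrix.star_eq_conjTranspose]; exact hu.star
    exact (L1_unit u _ hu (Ring.mul_inverse_cancel _ h1)).1
  obtain ⟨t, ht⟩ := exists_unit M
  have : D M 0 = D (t • 1 + M) 0 - t • D 1 0 := by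
    apply LinearMap.ext; intro x
    simp [D_apply, Matrix.smul_mulVec, Matrix.add_mulVec]
  rw [this]
  exact Submodule.sub_mem _ (key _ ht) (Submodule.smul_mem _ _ (key _ isUnit_one))

theorem L2 {p : ℕ} (M : Matrix (Fin p) (Fin p) (Quaternion ℝ)) :
    D 0 M ∈ Submodule.span ℝ (quatPairGroup p) := by
  have key : ∀ u : Matrix (Fin p) (Fin p) (Quaternion ℝ), IsUnit u →
      D 0 u ∈ Submodule.span ℝ (quatPairGroup p) := by
    intro u hu
    have h1 : IsUnit (star (Ring.inverse u)) := hu.ringInverse.star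
    refine (L1_unit _ u h1 ?_).2
    rw [← Matrix.star_eq_conjTranspose, star_star, Ring.inverse_mul_cancel _ hu]
  obtain ⟨t, ht⟩ := exists_unit M
  have : D 0 M = D 0 (t • 1 + M) - t • D 0 1 := by
    apply LinearMap.ext; intro x
    simp [D_apply, Matrix.smul_mulVec, Matrix.add_mulVec]
  rw [this]
  exact Submodule.sub_mem _ (key _ ht) (Submodule.smul_mem _ _ (key _ isUnit_one))

theorem inv_span {p : ℕ} (W : Submodule ℝ (QuatPairSpace p))
    (h : ∀ T ∈ quatPairGroup p, ∀ w ∈ W, T w ∈ W) :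
    ∀ T ∈ Submodule.span ℝ (quatPairGroup p), ∀ w ∈ W, T w ∈ W := by
  intro T hT w hw
  induction hT using Submodule.span_induction with
  | mem T hT => exact h T hT w hw
  | zero => simp
  | add a b _ _ ha hb => exact W.add_mem ha hb
  | smul c a _ ha => exact W.smul_mem c ha

theorem comm_span {p : ℕ} (A : Module.End ℝ (QuatPairSpace p))
    (h : ∀ T ∈ quatPairGroup p, T * A = A * T) :
    ∀ T ∈ Submodule.span ℝ (quatPairGroup p), ∀ x, A (T x) = T (A x) := by
  intro T hT x
  induction hT using Submodule.span_induction with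
  | mem T hT => exact (LinearMap.congr_fun (h T hT) x).symm
  | zero => simp
  | add a b _ _ ha hb => simp [ha, hb]
  | smul c a _ ha => simp [ha]

/-- the matrix with column `x` at place `k` -/
noncomputable def col {p : ℕ} (k : Fin p) (x : Fin p → Quaternion ℝ) : Matrix (Fin p) (Fin p) (Quaternion ℝ) :=
  fun i j => if j = k then x i else 0

theorem col_mulVec {p : ℕ} (k : Fin p) (x w : Fin p → Quaternion ℝ) :
    (col k x).mulVec w = fun i => x i * w k := by
  funext i
  simp [col, Matrix.mulVec, dotProduct]

theorem trans {p : ℕ} (x z : Fin p → Quaternion ℝ) (hx : x ≠ 0) :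
    ∃ M : Matrix (Fin p) (Fin p) (Quaternion ℝ), M.mulVec x = z := by
  obtain ⟨k, hk⟩ := Function.ne_iff.1 hx
  refine ⟨col k (fun i => z i * (x k)⁻¹), ?_⟩
  rw [col_mulVec]
  funext i
  have hk' : x k ≠ 0 := hk
  simp [mul_assoc, inv_mul_cancel₀ hk']

theorem sub_dichotomy {p : ℕ} (W : Submodule ℝ (QuatPairSpace p)) (hW : W ≠ ⊥)
    (h : ∀ T ∈ quatPairGroup p, ∀ w ∈ W, T w ∈ W) :
    (∀ z, ((z, 0) : QuatPairSpace p) ∈ W) ∨ (∀ z, ((0, z) : QuatPairSpace p) ∈ W) := by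
  obtain ⟨⟨x, y⟩, hw, hne⟩ := W.ne_bot_iff.1 hW
  have hi := inv_span W h
  by_cases hx : x = 0
  · have hy : y ≠ 0 := by
      rintro rfl; exact hne (by rw [hx]; rfl)
    right; intro z
    obtain ⟨M, hM⟩ := trans y z hy
    have := hi _ (L2 M) _ hw
    simpa [D_apply, hM] using this
  · left; intro z
    obtain ⟨M, hM⟩ := trans x z hx
    have := hi _ (L1 M) _ hw
    simpa [D_apply, hM] using this

theorem re_zero {p : ℕ} (x : Fin p → Quaternion ℝ) (h : (∑ i, star (x i) * x i).re ≤ 0) :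
    x = 0 := by
  have h1 : (∑ i, star (x i) * x i).re = ∑ i, Quaternion.normSq (x i) := by
    have : ∀ s : Finset (Fin p), (∑ i ∈ s, star (x i) * x i).re = ∑ i ∈ s, Quaternion.normSq (x i) := by
      intro s
      induction s using Finset.induction_on with
      | empty => rfl
      | insert a s ha ih =>
        rw [Finset.sum_insert ha, Finset.sum_insert ha, Quaternion.re_add, ih,
          Quaternion.star_mul_self, Quaternion.re_coe]
    exact this _
  rw [h1] at h
  have h2 := le_antisymm h (Finset.sum_nonneg fun i _ => Quaternion.normSq_nonneg)
  rw [Finset.sum_eq_zero_iff_of_nonneg (fun i _ => Quaternion.normSq_nonneg)] at h2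
  funext i
  exact Quaternion.normSq_eq_zero.1 (h2 i (Finset.mem_univ i))

theorem re_nonneg {p : ℕ} (x : Fin p → Quaternion ℝ) : 0 ≤ (∑ i, star (x i) * x i).re := by
  by_contra h
  push Not at h
  have := re_zero x h.le
  simp only [this, Pi.zero_apply, mul_zero, Finset.sum_const_zero] at h
  exact absurd h (lt_irrefl (0 : ℝ))

/-- The right-multiplication action of `ℍ × ℍ`. -/
noncomputable def R (p : ℕ) : (Quaternion ℝ × Quaternion ℝ) →ₐ[ℝ] Module.End ℝ (QuatPairSpace p) :=
  AlgHom.ofLinearMap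
    { toFun := fun c =>
        { toFun := fun x => (fun i => x.1 i * star c.1, fun i => x.2 i * star c.2)
          map_add' := fun x y => by
            refine Prod.ext ?_ ?_ <;> funext i <;> simp [add_mul]
          map_smul' := fun r x => by
            refine Prod.ext ?_ ?_ <;> funext i <;> simp }
      map_add' := fun c d => by
        apply LinearMap.ext; intro x
        refine Prod.ext ?_ ?_ <;> funext i <;> simp [mul_add]
      map_smul' := fun r c => by
        apply LinearMap.ext; intro x
        refine Prod.ext ?_ ?_ <;> funext i <;> simp }
    (by
      apply LinearMap.ext; intro x
      refine Prod.ext ?_ ?_ <;> funext i <;> simp)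
    (fun c d => by
      apply LinearMap.ext; intro x
      refine Prod.ext ?_ ?_ <;> funext i <;> simp [mul_assoc])

theorem R_apply (p : ℕ) (c : Quaternion ℝ × Quaternion ℝ) (x : QuatPairSpace p) :
    R p c x = (fun i => x.1 i * star c.1, fun i => x.2 i * star c.2) := rfl

theorem mulVec_right {p : ℕ} (M : Matrix (Fin p) (Fin p) (Quaternion ℝ)) (x : Fin p → Quaternion ℝ)
    (c : Quaternion ℝ) : M.mulVec (fun i => x i * c) = fun i => M.mulVec x i * c := by
  funext i
  simp [Matrix.mulVec, dotProduct, Finset.sum_mul, mul_assoc]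

theorem R_mem (p : ℕ) (c : Quaternion ℝ × Quaternion ℝ) :
    R p c ∈ Subalgebra.centralizer ℝ (quatPairGroup p) := by
  rw [Subalgebra.mem_centralizer_iff]
  rintro T ⟨u, hu, hT⟩
  apply LinearMap.ext; intro x
  simp only [Module.End.mul_apply, hT, R_apply, mulVec_right]

theorem R_inj (p : ℕ) (hp : 1 ≤ p) : Function.Injective (R p) := by
  intro c d h
  have := LinearMap.congr_fun h ((fun _ => 1, fun _ => 1) : QuatPairSpace p)
  simp only [R_apply, one_mul, Prod.mk.injEq] at this
  have h1 := congr_fun this.1 ⟨0, hp⟩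
  have h2 := congr_fun this.2 ⟨0, hp⟩
  exact Prod.ext (star_injective h1) (star_injective h2)

theorem R_surj (p : ℕ) (hp : 1 ≤ p) (A : Module.End ℝ (QuatPairSpace p))
    (hA : A ∈ Subalgebra.centralizer ℝ (quatPairGroup p)) : ∃ c, R p c = A := by
  rw [Subalgebra.mem_centralizer_iff] at hA
  have hc := comm_span A hA
  let k : Fin p := ⟨0, hp⟩
  let e : QuatPairSpace p := (fun _ => 1, fun _ => 1)
  refine ⟨(star ((A e).1 k), star ((A e).2 k)), ?_⟩
  apply LinearMap.ext; intro x
  have h1 := hc _ (L1 (col k x.1)) e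
  have h2 := hc _ (L2 (col k x.2)) e
  simp only [D_apply, col_mulVec, Matrix.zero_mulVec, e, mul_one] at h1 h2
  have : x = (x.1, 0) + (0, x.2) := by simp
  rw [R_apply]
  conv_rhs => rw [this, map_add]
  erw [h1, h2]
  simp [e]

theorem form_pres {p : ℕ} (u w : Matrix (Fin p) (Fin p) (Quaternion ℝ))
    (h : u.conjTranspose * w = 1) (x y : Fin p → Quaternion ℝ) :
    ∑ i, star (u.mulVec x i) * w.mulVec y i = ∑ i, star (x i) * y i := by
  change star (u.mulVec x) ⬝ᵥ w.mulVec y = star x ⬝ᵥ y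
  rw [Matrix.star_mulVec, ← Matrix.dotProduct_mulVec, Matrix.mulVec_mulVec, h, Matrix.one_mulVec]

end QPaux

/-- For the space `V = ℍᵖ × ℍᵖ` with the form `g` above and the set `S`
of maps `(x₁,x₂) ↦ (u·x₁, (u†)⁻¹·x₂)` (`u` invertible): (a) `g` is nondegenerate;
(b) every element of `S` preserves `g`; (c) the action of `S` is orthogonally
indecomposable; (d) the commutant of `S` in `End_ℝ(V)` is isomorphic, as a real algebra,
to `ℍ × ℍ`.  So, without the Bianchi identity, `ℍ ⊕ ℍ` occurs as an orthogonally
indecomposable self-adjoint semisimple commutant. -/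
theorem quaternionic_double_commutant_example (p : ℕ) (hp : 1 ≤ p) :
    (∀ x : QuatPairSpace p, (∀ y, quatPairForm p x y = 0) → x = 0) ∧
    (∀ T ∈ quatPairGroup p, ∀ x y : QuatPairSpace p,
      quatPairForm p (T x) (T y) = quatPairForm p x y) ∧
    (¬ ∃ W₁ W₂ : Submodule ℝ (QuatPairSpace p), W₁ ≠ ⊥ ∧ W₂ ≠ ⊥ ∧ IsCompl W₁ W₂ ∧
      (∀ u ∈ W₁, ∀ v ∈ W₂, quatPairForm p u v = 0) ∧
      (∀ T ∈ quatPairGroup p, ∀ w ∈ W₁, T w ∈ W₁) ∧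
      (∀ T ∈ quatPairGroup p, ∀ w ∈ W₂, T w ∈ W₂)) ∧
    Nonempty ((Subalgebra.centralizer ℝ (quatPairGroup p)) ≃ₐ[ℝ]
      (Quaternion ℝ × Quaternion ℝ)) := by
  refine ⟨?_, ?_, ?_, ?_⟩
  · intro x hx
    have h := hx (x.2, x.1)
    simp only [quatPairForm] at h
    have h1 := QPaux.re_nonneg x.1
    have h2 := QPaux.re_nonneg x.2
    exact Prod.ext (QPaux.re_zero x.1 (by linarith)) (QPaux.re_zero x.2 (by linarith))
  · rintro T ⟨u, hu, hT⟩ x y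
    have h1 : IsUnit u.conjTranspose := by
      rw [← Matrix.star_eq_conjTranspose]; exact hu.star
    simp only [quatPairForm, hT]
    rw [QPaux.form_pres u _ (Ring.mul_inverse_cancel _ h1),
      QPaux.form_pres u _ (Ring.mul_inverse_cancel _ h1)]
  · rintro ⟨W₁, W₂, hW₁, hW₂, hc, ho, i₁, i₂⟩
    let e : Fin p → Quaternion ℝ := fun _ => 1
    have he : e ≠ 0 := fun h => one_ne_zero (congr_fun h ⟨0, hp⟩)
    have hd : ∀ w, w ∈ W₁ → w ∈ W₂ → w = 0 := fun w a b =>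
      (Submodule.disjoint_def.1 hc.disjoint) w a b
    rcases QPaux.sub_dichotomy W₁ hW₁ i₁ with a | a <;>
    rcases QPaux.sub_dichotomy W₂ hW₂ i₂ with b | b
    · exact he (congrArg Prod.fst (hd _ (a e) (b e)))
    · have := ho _ (a e) _ (b e)
      simp only [quatPairForm] at this
      exact he (QPaux.re_zero e (by simpa using this.le))
    · have := ho _ (a e) _ (b e)
      simp only [quatPairForm] at this
      exact he (QPaux.re_zero e (by simpa using this.le))
    · exact he (congrArg Prod.snd (hd _ (a e) (b e)))
  · refine ⟨(AlgEquiv.ofBijective ((QPaux.R p).codRestrict _ (QPaux.R_mem p)) ⟨?_, ?_⟩).symm⟩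
    · intro c d h
      exact QPaux.R_inj p hp (congrArg Subtype.val h)
    · rintro ⟨A, hA⟩
      obtain ⟨c, hc⟩ := QPaux.R_surj p hp A hA
      exact ⟨c, Subtype.ext hc⟩
end
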